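/- arXiv:1006.2864 — 2 statements merged into one kernel-verified Lean document; each statement's English description precedes it below -/
import Mathlib

section
/- Synchronization by noise: if the random rotation number ρ_{τ,ε} is irrational, then for P-almost every ω ∈ Ω and for Lebesgue-almost every pair (x, y) ∈ (ℝ/ℤ)², the forward trajectories driven by the same noise realization synchronize: dist(φ(n,ω)(x), φ(n,ω)(y)) → 0 as n → +∞. -/
open MeasureTheory Real Filter Set Function

noncomputable section

lemma sin2_periodic : Function.Periodic (fun x : ℝ => Real.sin (2 * π * x)) 1 := by
  intro x
  simp only [mul_add, mul_one]
  exact Real.sin_add_two_pi _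

/-- `sin (2πx)` viewed as a function on the circle `ℝ/ℤ`. -/
def sinA : AddCircle (1:ℝ) → ℝ := sin2_periodic.lift

/-- The noisy Arnol'd circle map `F_w(x) = x + τ + σ w − ε sin (2πx)  (mod 1)`. -/
def Fmap (τ ε σ w : ℝ) : AddCircle (1:ℝ) → AddCircle (1:ℝ) :=
  fun x => x + (↑(τ + σ * w - ε * sinA x) : AddCircle (1:ℝ))

/-- The lift `G_w(x) = x + τ + σ w − ε sin (2πx)`. -/
def Gmap (τ ε σ w : ℝ) (x : ℝ) : ℝ :=
  x + τ + σ * w - ε * Real.sin (2 * π * x)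

/-- Iterated lifts `G^n_ω = G_{ω_{n−1}} ∘ ⋯ ∘ G_{ω_0}`. -/
def Gn (τ ε σ : ℝ) (ω : ℤ → ℝ) : ℕ → ℝ → ℝ
  | 0 => id
  | n + 1 => Gmap τ ε σ (ω n) ∘ Gn τ ε σ ω n

/-- The uniform probability measure on `I = [−1/2, 1/2]`. -/
def nuI : Measure ℝ := volume.restrict (Icc (-(1/2) : ℝ) (1/2))

/-- The forward random iterates `φ(0,ω) = id`, `φ(n,ω) = F_{ω_{n−1}} ∘ ⋯ ∘ F_{ω_0}`. -/
def phiN (τ ε σ : ℝ) (ω : ℤ → ℝ) : ℕ → AddCircle (1:ℝ) → AddCircle (1:ℝ)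
  | 0 => id
  | n + 1 => Fmap τ ε σ (ω n) ∘ phiN τ ε σ ω n

/-- `P` is the two-sided infinite product measure `ν^⊗ℤ` on `Ω = I^ℤ`, characterized by
its finite-dimensional marginals. -/
def IsProductNuZ (P : Measure (ℤ → ℝ)) : Prop :=
  IsProbabilityMeasure P ∧
    ∀ s : Finset ℤ, P.map (fun ω (i : s) => ω i) = Measure.pi (fun _ : s => nuI)

lemma sin_diff_bound {ε : ℝ} (hε : 0 < ε) (hεπ : 2 * π * ε < 1) {x y : ℝ} (hxy : x < y) :
    |ε * Real.sin (2 * π * y) - ε * Real.sin (2 * π * x)| < y - x := by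
  have h1 : |Real.sin (2 * π * y) - Real.sin (2 * π * x)| ≤ |2 * π * y - 2 * π * x| :=
    Real.abs_sin_sub_sin_le _ _
  have h2 : |2 * π * y - 2 * π * x| = 2 * π * (y - x) := by
    rw [← mul_sub, abs_of_pos]
    have := Real.pi_pos
    have : 0 < y - x := by linarith
    positivity
  rw [← mul_sub, abs_mul, abs_of_pos hε]
  rw [h2] at h1
  calc ε * |Real.sin (2 * π * y) - Real.sin (2 * π * x)| ≤ ε * (2 * π * (y - x)) := by gcongr
    _ = (2 * π * ε) * (y - x) := by ring
    _ < 1 * (y - x) := by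
      apply mul_lt_mul_of_pos_right hεπ; linarith
    _ = y - x := one_mul _

lemma Gmap_strictMono (τ σ w : ℝ) {ε : ℝ} (hε : 0 < ε) (hεπ : 2 * π * ε < 1) :
    StrictMono (Gmap τ ε σ w) := by
  intro x y hxy
  have := (abs_lt.1 (sin_diff_bound hε hεπ hxy)).2
  simp only [Gmap]; linarith

lemma Gmap_upper (τ σ w : ℝ) {ε : ℝ} (hε : 0 < ε) (hεπ : 2 * π * ε < 1) {x y : ℝ} (hxy : x ≤ y) :
    Gmap τ ε σ w y - Gmap τ ε σ w x ≤ 2 * (y - x) := by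
  rcases hxy.eq_or_lt with rfl | hxy
  · simp
  have := (abs_lt.1 (sin_diff_bound hε hεπ hxy)).1
  simp only [Gmap]; linarith

lemma Gmap_add_one (τ ε σ w x : ℝ) : Gmap τ ε σ w (x + 1) = Gmap τ ε σ w x + 1 := by
  have := sin2_periodic x
  simp only at this
  simp only [Gmap, this]; ring

lemma Gmap_eq_zero_add (τ ε σ w x : ℝ) : Gmap τ ε σ w x = Gmap τ ε σ 0 x + σ * w := by
  simp only [Gmap]; ring

lemma Gmap_cont (τ ε σ : ℝ) : Continuous (fun p : ℝ × ℝ => Gmap τ ε σ p.1 p.2) := by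
  unfold Gmap; fun_prop

lemma Gn_strictMono (τ σ : ℝ) {ε : ℝ} (hε : 0 < ε) (hεπ : 2 * π * ε < 1) (ω : ℤ → ℝ) (n : ℕ) :
    StrictMono (Gn τ ε σ ω n) := by
  induction n with
  | zero => exact strictMono_id
  | succ n ih => exact (Gmap_strictMono τ σ _ hε hεπ).comp ih

lemma Gn_add_one (τ ε σ : ℝ) (ω : ℤ → ℝ) (n : ℕ) (x : ℝ) :
    Gn τ ε σ ω n (x + 1) = Gn τ ε σ ω n x + 1 := by
  induction n with
  | zero => rfl
  | succ n ih => simp only [Gn, comp_apply, ih, Gmap_add_one]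

lemma Gn_le_Gn {τ σ ε : ℝ} (hε : 0 < ε) (hεπ : 2 * π * ε < 1) (hσ : 0 < σ) {ω ω' : ℤ → ℝ}
    (h : ∀ i, ω i ≤ ω' i) (n : ℕ) (x : ℝ) : Gn τ ε σ ω n x ≤ Gn τ ε σ ω' n x := by
  induction n with
  | zero => rfl
  | succ n ih =>
    simp only [Gn, comp_apply]
    refine ((Gmap_strictMono τ σ _ hε hεπ).monotone ih).trans ?_
    rw [Gmap_eq_zero_add, Gmap_eq_zero_add _ _ _ (ω' n)]
    have := mul_le_mul_of_nonneg_left (h n) hσ.le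
    linarith

/-- deg one lift as a bundled map -/
def Glift (τ σ w : ℝ) {ε : ℝ} (hε : 0 < ε) (hεπ : 2 * π * ε < 1) : CircleDeg1Lift where
  toFun := Gmap τ ε σ w
  monotone' := (Gmap_strictMono τ σ w hε hεπ).monotone
  map_add_one' := Gmap_add_one τ ε σ w

lemma Glift_pow (τ σ w : ℝ) {ε : ℝ} (hε : 0 < ε) (hεπ : 2 * π * ε < 1) (n : ℕ) (x : ℝ) :
    (Glift τ σ w hε hεπ ^ n) x = Gn τ ε σ (fun _ => w) n x := by
  induction n with
  | zero => rfl
  | succ n ih =>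
    rw [pow_succ', CircleDeg1Lift.mul_apply, ih]; rfl

lemma Gn_const_gap {τ σ ε : ℝ} (hε : 0 < ε) (hεπ : 2 * π * ε < 1) (hσ : 0 < σ) {c c' : ℝ}
    (h : c ≤ c') {n : ℕ} (hn : 0 < n) (x : ℝ) :
    Gn τ ε σ (fun _ => c) n x + σ * (c' - c) ≤ Gn τ ε σ (fun _ => c') n x := by
  obtain ⟨m, rfl⟩ : ∃ m, n = m + 1 := ⟨n - 1, by omega⟩
  simp only [Gn, comp_apply]
  have := (Gmap_strictMono τ σ c hε hεπ).monotone
    (Gn_le_Gn (τ := τ) hε hεπ hσ (ω := fun _ => c) (ω' := fun _ => c') (fun _ => h) m x)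
  rw [Gmap_eq_zero_add _ _ _ c'] 
  rw [Gmap_eq_zero_add, Gmap_eq_zero_add _ _ _ c] at this
  rw [Gmap_eq_zero_add _ _ _ c]
  linarith

lemma pigeon (u : ℕ → ℝ) {δ : ℝ} (hδ : 0 < δ) :
    ∃ i j : ℕ, i < j ∧ ∃ p : ℤ, |u j - u i - p| < δ := by
  have hc : IsCompact (Icc (0:ℝ) 1) := isCompact_Icc
  obtain ⟨a, -, φ, hφ, ht⟩ := hc.tendsto_subseq (x := fun n => Int.fract (u n))
    (fun n => ⟨Int.fract_nonneg _, (Int.fract_lt_one _).le⟩)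
  have hcs := ht.cauchySeq
  rw [Metric.cauchySeq_iff'] at hcs
  obtain ⟨N, hN⟩ := hcs δ hδ
  refine ⟨φ N, φ (N+1), hφ (Nat.lt_succ_self N), ⌊u (φ (N+1))⌋ - ⌊u (φ N)⌋, ?_⟩
  have := hN (N+1) (Nat.le_succ N)
  rw [Real.dist_eq] at this
  simp only [comp_apply, Int.fract] at this
  push_cast
  convert this using 2
  ring

lemma gap_lemma {τ σ ε ρ : ℝ} (hε : 0 < ε) (hεπ : 2 * π * ε < 1) (hσ : 0 < σ)
    (hirr : Irrational ρ) (ω : ℤ → ℝ) (hω : ∀ i, ω i ∈ Icc (-(1/2) : ℝ) (1/2))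
    (hρ : ∀ x : ℝ, Tendsto (fun n : ℕ => (Gn τ ε σ ω n x - x) / n) atTop (nhds ρ)) (a : ℝ) :
    ∃ n, Gn τ ε σ (fun _ => -(1/2)) n a + 1 ≤ Gn τ ε σ (fun _ => 1/2) n a := by
  by_contra! hcon
  have ht : ∀ w, Tendsto (fun n : ℕ => (Gn τ ε σ (fun _ => w) n a - a) / n) atTop
      (nhds (Glift τ σ w hε hεπ).translationNumber) := by
    intro w
    have := (Glift τ σ w hε hεπ).tendsto_translationNumber a
    simpa only [Glift_pow] using this
  have h1 : (Glift τ σ (-(1/2)) hε hεπ).translationNumber ≤ ρ := by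
    refine le_of_tendsto_of_tendsto' (ht _) (hρ a) (fun n => ?_)
    gcongr
    exact Gn_le_Gn hε hεπ hσ (fun i => (hω i).1) n a
  have h2 : ρ ≤ (Glift τ σ (1/2) hε hεπ).translationNumber := by
    refine le_of_tendsto_of_tendsto' (hρ a) (ht _) (fun n => ?_)
    gcongr
    exact Gn_le_Gn hε hεπ hσ (fun i => (hω i).2) n a
  have h3 : (Glift τ σ (1/2) hε hεπ).translationNumber ≤
      (Glift τ σ (-(1/2)) hε hεπ).translationNumber := by
    have hz : Tendsto (fun n : ℕ => (1:ℝ) / n) atTop (nhds 0) := tendsto_one_div_atTop_nhds_zero_nat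
    have := (ht (-(1/2))).add hz
    rw [add_zero] at this
    refine le_of_tendsto_of_tendsto' (ht _) this (fun n => ?_)
    rw [← add_div]
    gcongr
    have := hcon n
    linarith
  have hm : (Glift τ σ (-(1/2)) hε hεπ) ≤ (Glift τ σ 0 hε hεπ) := by
    intro x
    change Gmap _ _ _ _ _ ≤ Gmap _ _ _ _ _
    rw [Gmap_eq_zero_add]; linarith
  have hp : (Glift τ σ 0 hε hεπ) ≤ (Glift τ σ (1/2) hε hεπ) := by
    intro x
    change Gmap _ _ _ _ _ ≤ Gmap _ _ _ _ _
    rw [Gmap_eq_zero_add _ _ _ (1/2)]; linarith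
  have h4 := CircleDeg1Lift.translationNumber_mono hm
  have h5 := CircleDeg1Lift.translationNumber_mono hp
  have e0 : (Glift τ σ 0 hε hεπ).translationNumber = ρ := by linarith
  have ep : (Glift τ σ (1/2) hε hεπ).translationNumber = ρ := by linarith
  have em : (Glift τ σ (-(1/2)) hε hεπ).translationNumber = ρ := by linarith
  obtain ⟨i, j, hij, p, hr⟩ := pigeon (fun n => (Glift τ σ 0 hε hεπ ^ n) 0)
    (show 0 < σ / 2 by linarith)
  obtain ⟨q, rfl⟩ : ∃ q, j = q + i := ⟨j - i, by omega⟩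
  have hq : 0 < q := by omega
  simp only [pow_add, CircleDeg1Lift.mul_apply] at hr
  set x := (Glift τ σ 0 hε hεπ ^ i) 0
  have key : (q : ℝ) * ρ = p := by
    have u1 := Gn_const_gap (τ := τ) hε hεπ hσ (c := 0) (c' := 1/2) (by norm_num) hq x
    have u2 := Gn_const_gap (τ := τ) hε hεπ hσ (c := -(1/2)) (c' := 0) (by norm_num) hq x
    rw [← Glift_pow (hε := hε) (hεπ := hεπ), ← Glift_pow (hε := hε) (hεπ := hεπ)] at u1 u2
    obtain ⟨r1, r2⟩ := abs_lt.1 hr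
    rcases le_total ((Glift τ σ 0 hε hεπ ^ q) x - x - p) 0 with hs | hs
    · have a1 := CircleDeg1Lift.translationNumber_le_of_le_add_int
        (f := (Glift τ σ 0 hε hεπ ^ q)) (x := x) (m := p) (by linarith)
      have a2 := CircleDeg1Lift.le_translationNumber_of_add_int_le
        (f := (Glift τ σ (1/2) hε hεπ ^ q)) (x := x) (m := p) (by linarith)
      rw [CircleDeg1Lift.translationNumber_pow] at a1 a2
      rw [e0] at a1; rw [ep] at a2
      linarith
    · have a1 := CircleDeg1Lift.le_translationNumber_of_add_int_le
        (f := (Glift τ σ 0 hε hεπ ^ q)) (x := x) (m := p) (by linarith)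
      have a2 := CircleDeg1Lift.translationNumber_le_of_le_add_int
        (f := (Glift τ σ (-(1/2)) hε hεπ ^ q)) (x := x) (m := p) (by linarith)
      rw [CircleDeg1Lift.translationNumber_pow] at a1 a2
      rw [e0] at a1; rw [em] at a2
      linarith
  have hq' : (q : ℝ) ≠ 0 := by positivity
  apply hirr
  refine ⟨(p : ℚ) / q, ?_⟩
  push_cast
  rw [← key]; field_simp

instance nuI_prob : IsProbabilityMeasure nuI := by
  constructor
  simp [nuI]
  norm_num

/-- continuous monotone maps of degree one -/
structure Deg1 (h : ℝ → ℝ) : Prop where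
  cont : Continuous h
  mono : Monotone h
  add_one : ∀ x, h (x + 1) = h x + 1

lemma Deg1.add_int {h : ℝ → ℝ} (hh : Deg1 h) (x : ℝ) (n : ℤ) : h (x + n) = h x + n := by
  let f : CircleDeg1Lift := ⟨⟨h, hh.mono⟩, hh.add_one⟩
  exact f.map_add_int x n

lemma Deg1.upper {h : ℝ → ℝ} (hh : Deg1 h) (x y : ℝ) : h y ≤ h x + (y - x) + 1 := by
  have h1 : h y ≤ h (x + (⌈y - x⌉ : ℤ)) := hh.mono (by linarith [Int.le_ceil (y - x)])
  rw [hh.add_int] at h1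
  linarith [Int.ceil_lt_add_one (y - x)]

lemma Deg1.bound {h : ℝ → ℝ} (hh : Deg1 h) (x : ℝ) : |h x - h 0| ≤ |x| + 1 := by
  have h1 := hh.upper 0 x
  have h2 := hh.upper x 0
  rw [abs_le]
  constructor <;> linarith [le_abs_self x, neg_abs_le x]

lemma integrable_nuI {f : ℝ → ℝ} (hf : Continuous f) : Integrable f nuI :=
  hf.integrableOn_Icc

/-- The averaging operator. -/
def avT (τ ε σ : ℝ) (h : ℝ → ℝ) (x : ℝ) : ℝ := ∫ w, h (Gmap τ ε σ w x) ∂nuI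

lemma Gmap_cont_w (τ ε σ x : ℝ) : Continuous (fun w => Gmap τ ε σ w x) :=
  (Gmap_cont τ ε σ).comp (by fun_prop : Continuous fun w : ℝ => (w, x))

lemma Gmap_cont_x (τ ε σ w : ℝ) : Continuous (fun x => Gmap τ ε σ w x) :=
  (Gmap_cont τ ε σ).comp (by fun_prop : Continuous fun x : ℝ => (w, x))

lemma avT_deg1 {τ σ ε : ℝ} (hε : 0 < ε) (hεπ : 2 * π * ε < 1) {h : ℝ → ℝ} (hh : Deg1 h) :
    Deg1 (avT τ ε σ h) := by
  have hi : ∀ x, Integrable (fun w => h (Gmap τ ε σ w x)) nuI := fun x =>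
    integrable_nuI (hh.cont.comp (Gmap_cont_w τ ε σ x))
  refine ⟨?_, ?_, ?_⟩
  · have : Continuous (fun p : ℝ × ℝ => h (Gmap τ ε σ p.2 p.1)) :=
      hh.cont.comp ((Gmap_cont τ ε σ).comp continuous_swap)
    exact continuous_parametric_integral_of_continuous (f := fun x w => h (Gmap τ ε σ w x))
      this isCompact_Icc
  · intro x y hxy
    exact integral_mono (hi x) (hi y) (fun w => hh.mono ((Gmap_strictMono τ σ w hε hεπ).monotone hxy))
  · intro x
    simp only [avT, Gmap_add_one, hh.add_one]
    rw [integral_add (hi x) (integrable_const _)]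
    simp

lemma avT_eq {τ σ ε : ℝ} (hσ : 0 < σ) (h : ℝ → ℝ) (x : ℝ) :
    avT τ ε σ h x = σ⁻¹ * ∫ s in (Gmap τ ε σ 0 x - σ/2)..(Gmap τ ε σ 0 x + σ/2), h s := by
  unfold avT nuI
  rw [integral_Icc_eq_integral_Ioc, ← intervalIntegral.integral_of_le (by norm_num)]
  have e : (fun w => h (Gmap τ ε σ w x)) = fun w => h (Gmap τ ε σ 0 x + σ * w) := by
    funext w; rw [Gmap_eq_zero_add]
  rw [e]
  rw [intervalIntegral.integral_comp_add_mul (fun s => h s) hσ.ne']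
  rw [smul_eq_mul]
  congr 2 <;> ring

lemma avT_modulus {τ σ ε : ℝ} (hε : 0 < ε) (hεπ : 2 * π * ε < 1) (hσ : 0 < σ) {h : ℝ → ℝ}
    (hh : Deg1 h) {x y : ℝ} (hxy : x ≤ y) :
    avT τ ε σ h y - avT τ ε σ h x ≤ σ⁻¹ * (2 * (y - x) * (2 * (y - x) + σ + 1)) := by
  rw [avT_eq hσ, avT_eq hσ, ← mul_sub]
  have huv := (Gmap_strictMono τ σ 0 hε hεπ).monotone hxy
  have huv2 := Gmap_upper τ σ 0 hε hεπ hxy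
  set u := Gmap τ ε σ 0 x
  set v := Gmap τ ε σ 0 y
  have ii : ∀ a b, IntervalIntegrable h volume a b := fun a b => hh.cont.intervalIntegrable a b
  gcongr
  rw [intervalIntegral.integral_interval_sub_interval_comm' (ii _ _) (ii _ _) (ii _ _)]
  have h1 : ∫ s in (u + σ/2)..(v + σ/2), h s ≤ (v - u) * h (v + σ/2) := by
    have := intervalIntegral.integral_mono_on (a := u + σ/2) (b := v + σ/2) (by linarith)
      (ii _ _) (g := fun _ => h (v + σ/2)) (by simp) (fun s hs => hh.mono hs.2)
    simpa using this
  have h2 : (v - u) * h (u - σ/2) ≤ ∫ s in (u - σ/2)..(v - σ/2), h s := by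
    have := intervalIntegral.integral_mono_on (a := u - σ/2) (b := v - σ/2) (by linarith)
      (f := fun _ => h (u - σ/2)) (by simp) (ii _ _) (fun s hs => hh.mono hs.1)
    simpa using this
  have h3 := hh.upper (u - σ/2) (v + σ/2)
  calc _ ≤ (v - u) * (h (v + σ/2) - h (u - σ/2)) := by linarith
    _ ≤ (v - u) * (2 * (y - x) + σ + 1) := by
      apply mul_le_mul_of_nonneg_left _ (by linarith)
      linarith
    _ ≤ _ := by
      apply mul_le_mul_of_nonneg_right huv2
      linarith

lemma compactness (A : ℕ → ℝ → ℝ) (hA : ∀ n, Deg1 (A n)) (h0 : ∀ n, A n 0 = 0) (m : ℝ → ℝ)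
    (hm : Continuous m) (hm0 : m 0 = 0) (hmA : ∀ n x y, x ≤ y → A n y - A n x ≤ m (y - x)) :
    ∃ φ : ℕ → ℕ, StrictMono φ ∧ ∃ h, Deg1 h ∧
      ∀ x, Tendsto (fun n => A (φ n) x) atTop (nhds (h x)) := by
  have hK : IsCompact (Set.univ.pi (fun q : ℚ => Icc (-(|(q:ℝ)| + 1)) (|(q:ℝ)| + 1))) :=
    isCompact_univ_pi (fun q => isCompact_Icc)
  obtain ⟨a, -, φ, hφ, ht⟩ := hK.tendsto_subseq (x := fun n (q : ℚ) => A n q) (by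
    intro n q _
    have := (hA n).bound q
    rw [h0, sub_zero] at this
    exact abs_le.1 this)
  rw [tendsto_pi_nhds] at ht
  have hC : ∀ x, ∃ l, Tendsto (fun n => A (φ n) x) atTop (nhds l) := by
    intro x
    apply cauchySeq_tendsto_of_complete
    rw [Metric.cauchySeq_iff]
    intro η hη
    have : ∀ᶠ d in nhds (0:ℝ), m d < η / 3 := by
      have := hm.tendsto 0
      rw [hm0] at this
      exact this.eventually (gt_mem_nhds (by linarith))
    obtain ⟨δ, hδ, hd⟩ := Metric.eventually_nhds_iff.1 this
    obtain ⟨q, hq1, hq2⟩ := exists_rat_btwn (show x < x + δ by linarith)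
    obtain ⟨N, hN⟩ := Metric.cauchySeq_iff.1 (ht q).cauchySeq (η/3) (by linarith)
    refine ⟨N, fun i hi j hj => ?_⟩
    have e := hN i hi j hj
    have hmq : m (q - x) < η / 3 := hd (by rw [Real.dist_eq, abs_lt]; constructor <;> linarith)
    have e1 := hmA (φ i) x q hq1.le
    have e2 := hmA (φ j) x q hq1.le
    have e3 := (hA (φ i)).mono hq1.le
    have e4 := (hA (φ j)).mono hq1.le
    simp only [comp_apply] at e
    rw [Real.dist_eq, abs_lt] at e ⊢
    constructor <;> linarith
  choose h hh using hC
  have hmono : Monotone h := fun x y hxy =>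
    le_of_tendsto_of_tendsto' (hh x) (hh y) (fun n => (hA _).mono hxy)
  have hmod : ∀ x y, x ≤ y → h y - h x ≤ m (y - x) := fun x y hxy =>
    le_of_tendsto' ((hh y).sub (hh x)) (fun n => hmA _ x y hxy)
  refine ⟨φ, hφ, h, ⟨?_, hmono, ?_⟩, hh⟩
  · rw [continuous_iff_continuousAt]
    intro x
    rw [ContinuousAt, tendsto_iff_dist_tendsto_zero]
    have hc : Continuous (fun y => m |y - x|) := by fun_prop
    have := hc.tendsto x
    simp only [sub_self, abs_zero, hm0] at this
    refine squeeze_zero (fun _ => dist_nonneg) (fun y => ?_) this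
    rw [Real.dist_eq]
    rcases le_total x y with hxy | hxy
    · rw [abs_of_nonneg (sub_nonneg.2 (hmono hxy)), abs_of_nonneg (sub_nonneg.2 hxy)]
      exact hmod x y hxy
    · rw [abs_sub_comm, abs_of_nonneg (sub_nonneg.2 (hmono hxy)), abs_sub_comm,
        abs_of_nonneg (sub_nonneg.2 hxy)]
      exact hmod y x hxy
  · intro x
    refine tendsto_nhds_unique (hh (x+1)) ?_
    simp_rw [(hA _).add_one]
    exact (hh x).add_const 1

lemma exists_h {τ σ ε : ℝ} (hε : 0 < ε) (hεπ : 2 * π * ε < 1) (hσ : 0 < σ) :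
    ∃ h c, Deg1 h ∧ ∀ x, avT τ ε σ h x = h x + c := by
  let f : ℕ → ℝ → ℝ := fun k => (avT τ ε σ)^[k] id
  have hf : ∀ k, Deg1 (f k) := by
    intro k
    induction k with
    | zero => exact ⟨continuous_id, monotone_id, fun x => rfl⟩
    | succ k ih =>
      simp only [f, iterate_succ_apply']
      exact avT_deg1 hε hεπ ih
  have hfs : ∀ k, f (k+1) = avT τ ε σ (f k) := fun k => by simp only [f, iterate_succ_apply']
  let A : ℕ → ℝ → ℝ := fun n x => (∑ k ∈ Finset.range (n+1), (f (k+1) x - f (k+1) 0)) / (n+1 : ℝ)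
  have hpos : ∀ n : ℕ, (0:ℝ) < n + 1 := fun n => by positivity
  have hAd : ∀ n, Deg1 (A n) := by
    intro n
    refine ⟨?_, ?_, ?_⟩
    · have := fun k => (hf k).cont
      fun_prop
    · intro x y hxy
      simp only [A]
      gcongr with k hk
      exact (hf _).mono hxy
    · intro x
      simp only [A, (hf _).add_one]
      rw [div_add_one (hpos n).ne']
      congr 1
      have : ∀ k, f (k+1) x + 1 - f (k+1) 0 = (f (k+1) x - f (k+1) 0) + 1 := fun k => by ring
      simp_rw [this, Finset.sum_add_distrib]
      simp
  obtain ⟨φ, hφ, h, hh, hlim⟩ := compactness A hAd (fun n => by simp [A])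
    (fun d => σ⁻¹ * (2 * d * (2 * d + σ + 1))) (by fun_prop) (by simp) (by
      intro n x y hxy
      simp only [A]
      rw [div_sub_div_same, ← Finset.sum_sub_distrib, div_le_iff₀ (hpos n)]
      calc _ ≤ ∑ k ∈ Finset.range (n+1), σ⁻¹ * (2 * (y - x) * (2 * (y - x) + σ + 1)) := by
            apply Finset.sum_le_sum
            intro k _
            have := avT_modulus (τ := τ) hε hεπ hσ (hf k) hxy
            rw [← hfs] at this
            linarith
        _ = _ := by simp [mul_comm])
  refine ⟨h, avT τ ε σ h 0 - h 0, hh, fun x => ?_⟩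
  have hTlim : ∀ x, Tendsto (fun n => avT τ ε σ (A (φ n)) x) atTop (nhds (avT τ ε σ h x)) := by
    intro x
    refine tendsto_integral_of_dominated_convergence (fun w => |Gmap τ ε σ w x| + 1) ?_ ?_ ?_ ?_
    · intro n
      exact ((hAd _).cont.comp (Gmap_cont_w τ ε σ x)).aestronglyMeasurable
    · have := Gmap_cont_w τ ε σ x
      exact integrable_nuI (by fun_prop)
    · intro n
      filter_upwards with w
      have := (hAd (φ n)).bound (Gmap τ ε σ w x)
      have h00 : A (φ n) 0 = 0 := by simp [A]
      rw [h00, sub_zero] at this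
      exact this
    · filter_upwards with w
      exact hlim _
  have hTA : ∀ n x, avT τ ε σ (A n) x =
      (∑ k ∈ Finset.range (n+1), (f (k+2) x - f (k+1) 0)) / (n+1 : ℝ) := by
    intro n x
    simp only [avT, A]
    rw [integral_div, integral_finsetSum]
    · congr 1
      apply Finset.sum_congr rfl
      intro k _
      have hi : Integrable (fun w => f (k+1) (Gmap τ ε σ w x)) nuI :=
        integrable_nuI ((hf (k+1)).cont.comp (Gmap_cont_w τ ε σ x))
      rw [integral_sub hi (integrable_const _)]
      rw [hfs (k+1)]
      simp [avT]
    · intro k _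
      have := Gmap_cont_w τ ε σ x
      have := (hf (k+1)).cont
      exact integrable_nuI (by fun_prop)
  have hdiff : ∀ n x, avT τ ε σ (A n) x - A n x = (f (n+2) x - f 1 x) / (n+1) := by
    intro n x
    rw [hTA]
    simp only [A]
    rw [div_sub_div_same, ← Finset.sum_sub_distrib]
    congr 1
    have := Finset.sum_range_sub (fun k => f (k+1) x) (n+1)
    rw [← this]
    exact Finset.sum_congr rfl (fun k _ => by ring)
  have hz : Tendsto (fun n => (avT τ ε σ (A (φ n)) x - A (φ n) x) -
      (avT τ ε σ (A (φ n)) 0 - A (φ n) 0)) atTop (nhds 0) := by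
    have hb : Tendsto (fun n : ℕ => (2 * (|x| + 1)) * (1 / ((n:ℝ) + 1))) atTop (nhds 0) := by
      simpa using tendsto_one_div_add_atTop_nhds_zero_nat.const_mul (2 * (|x| + 1))
    refine squeeze_zero_norm (fun n => ?_) (hb.comp hφ.tendsto_atTop)
    rw [hdiff, hdiff, div_sub_div_same, Real.norm_eq_abs, abs_div, abs_of_pos (hpos _)]
    simp only [comp_apply]
    rw [mul_one_div]
    gcongr
    have b1 := abs_le.1 ((hf (φ n + 2)).bound x)
    have b2 := abs_le.1 ((hf 1).bound x)
    rw [abs_le]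
    constructor <;> linarith [b1.1, b1.2, b2.1, b2.2]
  have := tendsto_nhds_unique hz (((hTlim x).sub (hlim x)).sub ((hTlim 0).sub (hlim 0)))
  linarith

lemma zero_of_integral {f : ℝ → ℝ} (hf : Continuous f) (h0 : ∀ w, 0 ≤ f w)
    (hi : ∫ w, f w ∂nuI = 0) : ∀ w ∈ Icc (-(1/2) : ℝ) (1/2), f w = 0 := by
  have h1 := (integral_eq_zero_iff_of_nonneg (μ := nuI) (f := f) h0 (integrable_nuI hf)).1 hi
  have := Measure.eqOn_Icc_of_ae_eq (μ := volume) (a := -(1/2)) (b := 1/2) (f := f) (g := 0)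
    (by norm_num) h1 hf.continuousOn continuousOn_const
  exact this

lemma flat_step {τ σ ε c : ℝ} (hε : 0 < ε) (hεπ : 2 * π * ε < 1) (hσ : 0 < σ)
    {h : ℝ → ℝ} (hh : Deg1 h) (hT : ∀ x, avT τ ε σ h x = h x + c) {a b : ℝ} (hab : a < b)
    (he : h a = h b) : h (Gmap τ ε σ (-(1/2)) a) = h (Gmap τ ε σ (1/2) b) := by
  have hi : ∀ x, Integrable (fun w => h (Gmap τ ε σ w x)) nuI := fun x =>
    integrable_nuI (hh.cont.comp (Gmap_cont_w τ ε σ x))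
  have hz := zero_of_integral (f := fun w => h (Gmap τ ε σ w b) - h (Gmap τ ε σ w a))
    ((hh.cont.comp (Gmap_cont_w τ ε σ b)).sub (hh.cont.comp (Gmap_cont_w τ ε σ a)))
    (fun w => sub_nonneg.2 (hh.mono ((Gmap_strictMono τ σ w hε hεπ).monotone hab.le)))
    (by
      rw [integral_sub (hi b) (hi a)]
      have h1 := hT a
      have h2 := hT b
      unfold avT at h1 h2
      rw [h1, h2, he]; ring)
  have hg := Gmap_strictMono τ σ 0 hε hεπ hab
  set ga := Gmap τ ε σ 0 a with hga
  set gb := Gmap τ ε σ 0 b with hgb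
  have hz' : ∀ u, ga - σ/2 ≤ u → u ≤ ga + σ/2 → h (u + (gb - ga)) = h u := by
    intro u h1 h2
    have := hz ((u - ga)/σ) ⟨by rw [le_div_iff₀ hσ]; linarith, by rw [div_le_iff₀ hσ]; linarith⟩
    rw [Gmap_eq_zero_add, Gmap_eq_zero_add _ _ _ _ a, mul_div_cancel₀ _ hσ.ne', ← hga, ← hgb] at this
    have e1 : u + (gb - ga) = gb + (u - ga) := by ring
    have e2 : u = ga + (u - ga) := by ring
    rw [e1]
    conv_rhs => rw [e2]
    linarith
  have hind : ∀ j : ℕ, h (min (ga - σ/2 + j * (gb - ga)) (ga + σ/2)) = h (ga - σ/2) := by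
    intro j
    induction j with
    | zero => congr 1; simp; linarith
    | succ j ih =>
      have hj : (0:ℝ) ≤ j * (gb - ga) := mul_nonneg (by positivity) (by linarith)
      push_cast
      rcases le_total (ga - σ/2 + j * (gb - ga)) (ga + σ/2) with hle | hle
      · rw [min_eq_left hle] at ih
        have e := hz' _ (by linarith) hle
        apply le_antisymm
        · rw [← ih, ← e]
          apply hh.mono
          refine (min_le_left _ _).trans (by linarith)
        · apply hh.mono
          apply le_min <;> linarith
      · rw [min_eq_right hle] at ih
        rw [min_eq_right (by linarith)]
        exact ih
  obtain ⟨j, hj⟩ := exists_nat_gt (σ / (gb - ga))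
  rw [div_lt_iff₀ (by linarith)] at hj
  have h1 := hind j
  rw [min_eq_right (by linarith)] at h1
  have h2 := hz' (ga + σ/2) (by linarith) le_rfl
  rw [Gmap_eq_zero_add, Gmap_eq_zero_add _ _ _ _ b, ← hga, ← hgb]
  rw [show ga + σ * -(1/2) = ga - σ/2 by ring, ← h1, ← h2]
  congr 1; ring

lemma h_strictMono {τ σ ε c : ℝ} (hε : 0 < ε) (hεπ : 2 * π * ε < 1) (hσ : 0 < σ)
    (hgap : ∀ a, ∃ n, Gn τ ε σ (fun _ => -(1/2)) n a + 1 ≤ Gn τ ε σ (fun _ => 1/2) n a)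
    {h : ℝ → ℝ} (hh : Deg1 h) (hT : ∀ x, avT τ ε σ h x = h x + c) : StrictMono h := by
  intro a b hab
  refine lt_of_le_of_ne (hh.mono hab.le) (fun he => ?_)
  have key : ∀ n, Gn τ ε σ (fun _ => -(1/2)) n a < Gn τ ε σ (fun _ => 1/2) n b ∧
      h (Gn τ ε σ (fun _ => -(1/2)) n a) = h (Gn τ ε σ (fun _ => 1/2) n b) := by
    intro n
    induction n with
    | zero => exact ⟨hab, he⟩
    | succ n ih =>
      refine ⟨?_, flat_step hε hεπ hσ hh hT ih.1 ih.2⟩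
      simp only [Gn, comp_apply]
      have := Gmap_strictMono τ σ (-(1/2)) hε hεπ ih.1
      rw [Gmap_eq_zero_add _ _ _ (1/2)]
      rw [Gmap_eq_zero_add _ _ _ (-(1/2)) (Gn τ ε σ (fun _ => 1/2) n b)] at this
      linarith
  obtain ⟨n, hn⟩ := hgap a
  have h1 := (key n).2
  have h2 := Gn_strictMono τ σ hε hεπ (fun _ => 1/2) n hab
  have h3 := hh.mono (hn.trans h2.le)
  rw [hh.add_one] at h3
  linarith

/-- two-point transition operator -/
def Sop (τ ε σ : ℝ) (f : ℝ × ℝ → ℝ) (p : ℝ × ℝ) : ℝ :=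
  ∫ w, f (Gmap τ ε σ w p.1, Gmap τ ε σ w p.2) ∂nuI

/-- one-step variance of the increment -/
def Vf (τ ε σ : ℝ) (h : ℝ → ℝ) (p : ℝ × ℝ) : ℝ :=
  ∫ w, ((h (Gmap τ ε σ w p.2) - h (Gmap τ ε σ w p.1)) - (h p.2 - h p.1)) ^ 2 ∂nuI

lemma pair_cont (τ ε σ : ℝ) :
    Continuous (fun q : (ℝ × ℝ) × ℝ => (Gmap τ ε σ q.2 q.1.1, Gmap τ ε σ q.2 q.1.2)) := by
  unfold Gmap; fun_prop

lemma pair_cont_w (τ ε σ : ℝ) (p : ℝ × ℝ) :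
    Continuous (fun w : ℝ => (Gmap τ ε σ w p.1, Gmap τ ε σ w p.2)) := by
  unfold Gmap; fun_prop

lemma Sop_cont {τ ε σ : ℝ} {f : ℝ × ℝ → ℝ} (hf : Continuous f) : Continuous (Sop τ ε σ f) :=
  continuous_parametric_integral_of_continuous
    (f := fun (p : ℝ × ℝ) (w : ℝ) => f (Gmap τ ε σ w p.1, Gmap τ ε σ w p.2)) (hf.comp (pair_cont τ ε σ)) isCompact_Icc

lemma Sop_nonneg {τ ε σ : ℝ} {f : ℝ × ℝ → ℝ} (hf : ∀ p, 0 ≤ f p) (p : ℝ × ℝ) :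
    0 ≤ Sop τ ε σ f p := integral_nonneg (fun _ => hf _)

lemma Vf_integrand_cont {τ ε σ : ℝ} {h : ℝ → ℝ} (hh : Continuous h) :
    Continuous (fun q : (ℝ × ℝ) × ℝ =>
      ((h (Gmap τ ε σ q.2 q.1.2) - h (Gmap τ ε σ q.2 q.1.1)) - (h q.1.2 - h q.1.1)) ^ 2) := by
  unfold Gmap; fun_prop

lemma Vf_cont {τ ε σ : ℝ} {h : ℝ → ℝ} (hh : Continuous h) : Continuous (Vf τ ε σ h) := by
  have := continuous_parametric_integral_of_continuous (μ := volume)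
    (f := fun (p : ℝ × ℝ) (w : ℝ) =>
      ((h (Gmap τ ε σ w p.2) - h (Gmap τ ε σ w p.1)) - (h p.2 - h p.1)) ^ 2)
    (Vf_integrand_cont hh) (isCompact_Icc (a := (-(1/2) : ℝ)) (b := 1/2))
  unfold Vf nuI
  exact this

lemma Vf_nonneg {τ ε σ : ℝ} {h : ℝ → ℝ} (p : ℝ × ℝ) : 0 ≤ Vf τ ε σ h p :=
  integral_nonneg (fun _ => sq_nonneg _)

lemma SopV_cont {τ ε σ : ℝ} {h : ℝ → ℝ} (hh : Continuous h) (k : ℕ) :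
    Continuous ((Sop τ ε σ)^[k] (Vf τ ε σ h)) := by
  induction k with
  | zero => exact Vf_cont hh
  | succ k ih => rw [iterate_succ_apply']; exact Sop_cont ih

lemma SopV_nonneg {τ ε σ : ℝ} {h : ℝ → ℝ} (k : ℕ) (p : ℝ × ℝ) :
    0 ≤ (Sop τ ε σ)^[k] (Vf τ ε σ h) p := by
  induction k generalizing p with
  | zero => exact Vf_nonneg p
  | succ k ih => rw [iterate_succ_apply']; exact Sop_nonneg ih p

lemma V_zero_word {τ ε σ : ℝ} {h : ℝ → ℝ} (hh : Continuous h) {w : ℝ}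
    (hw : w ∈ Icc (-(1/2) : ℝ) (1/2)) {x y : ℝ}
    (hz : ∀ k, (Sop τ ε σ)^[k] (Vf τ ε σ h) (x, y) = 0) (n : ℕ) :
    ∀ k, (Sop τ ε σ)^[k] (Vf τ ε σ h) (Gn τ ε σ (fun _ => w) n x, Gn τ ε σ (fun _ => w) n y) = 0 := by
  induction n with
  | zero => exact hz
  | succ n ih =>
    intro k
    have := ih (k+1)
    rw [iterate_succ_apply'] at this
    exact zero_of_integral ((SopV_cont hh k).comp (pair_cont_w τ ε σ _)) (fun w => SopV_nonneg k _)
      this w hw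

lemma V_zero_step {τ ε σ : ℝ} {h : ℝ → ℝ} (hh : Continuous h) {w : ℝ}
    (hw : w ∈ Icc (-(1/2) : ℝ) (1/2)) {x y : ℝ} (hz : Vf τ ε σ h (x, y) = 0) :
    h (Gmap τ ε σ w y) - h (Gmap τ ε σ w x) = h y - h x := by
  have hc : Continuous (fun w => ((h (Gmap τ ε σ w y) - h (Gmap τ ε σ w x)) - (h y - h x)) ^ 2) := by
    unfold Gmap; fun_prop
  have := zero_of_integral hc (fun w => sq_nonneg _) hz w hw
  have := pow_eq_zero_iff (two_ne_zero) |>.1 this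
  linarith

lemma Gn_const_cont (τ ε σ x : ℝ) (n : ℕ) : Continuous (fun w => Gn τ ε σ (fun _ => w) n x) := by
  induction n with
  | zero => exact continuous_const
  | succ n ih =>
    exact (Gmap_cont τ ε σ).comp (continuous_id.prodMk ih)

lemma rigidity {τ σ ε : ℝ} (hε : 0 < ε) (hεπ : 2 * π * ε < 1) (hσ : 0 < σ)
    (hgap : ∀ a, ∃ n, Gn τ ε σ (fun _ => -(1/2)) n a + 1 ≤ Gn τ ε σ (fun _ => 1/2) n a)
    {h : ℝ → ℝ} (hh : Deg1 h) (hs : StrictMono h) {x y : ℝ}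
    (hz : ∀ k, (Sop τ ε σ)^[k] (Vf τ ε σ h) (x, y) = 0) (h0 : 0 < h y - h x) (h1 : h y - h x < 1) :
    False := by
  set d := h y - h x with hd
  -- words preserve the increment
  have hword : ∀ w ∈ Icc (-(1/2) : ℝ) (1/2), ∀ n,
      h (Gn τ ε σ (fun _ => w) n y) - h (Gn τ ε σ (fun _ => w) n x) = d := by
    intro w hw n
    induction n with
    | zero => rfl
    | succ n ih =>
      rw [← ih]
      exact V_zero_step hh.cont hw (V_zero_word hh.cont hw hz n 0)
  obtain ⟨n, hn⟩ := hgap x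
  -- every point has a partner
  have hpart : ∀ z, ∃ z', h z' - h z = d ∧ ∀ w ∈ Icc (-(1/2) : ℝ) (1/2),
      h (Gmap τ ε σ w z') - h (Gmap τ ε σ w z) = d := by
    intro z
    set L := Gn τ ε σ (fun _ => -(1/2)) n x
    obtain ⟨m, hm1, hm2⟩ : ∃ m : ℤ, L ≤ z + m ∧ z + m ≤ L + 1 := by
      refine ⟨⌈L - z⌉, ?_, ?_⟩
      · linarith [Int.le_ceil (L - z)]
      · linarith [Int.ceil_lt_add_one (L - z)]
    obtain ⟨c, hc, hcz⟩ := intermediate_value_Icc (show (-(1/2) : ℝ) ≤ 1/2 by norm_num)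
      (Gn_const_cont τ ε σ x n).continuousOn ⟨hm1, hm2.trans hn⟩
    simp only [] at hcz
    refine ⟨Gn τ ε σ (fun _ => c) n y - m, ?_, ?_⟩
    · have := hword c hc n
      rw [hcz, hh.add_int] at this
      have e := hh.add_int (Gn τ ε σ (fun _ => c) n y - m) m
      rw [sub_add_cancel] at e
      linarith
    · intro w hw
      have e1 := V_zero_step hh.cont hw (V_zero_word hh.cont hc hz n 0)
      rw [hword c hc n, hcz] at e1
      have e2 : ∀ u, Gmap τ ε σ w (u + m) = Gmap τ ε σ w u + m :=
        fun u => (Glift τ σ w hε hεπ).map_add_int u m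
      have e3 := e2 (Gn τ ε σ (fun _ => c) n y - m)
      rw [sub_add_cancel] at e3
      rw [e2, e3, hh.add_int, hh.add_int] at e1
      linarith
  choose ψ hψ1 hψ2 using hpart
  have huniq : ∀ z u, h u - h z = d → u = ψ z := fun z u hu => hs.injective (by linarith [hψ1 z])
  have hcomm : ∀ z, ∀ w ∈ Icc (-(1/2) : ℝ) (1/2), Gmap τ ε σ w (ψ z) = ψ (Gmap τ ε σ w z) :=
    fun z w hw => huniq _ _ (hψ2 z w hw)
  have hsurj : ∀ u, ∃ z, Gmap τ ε σ 0 z = u := by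
    intro u
    have hc := Gmap_cont_x τ ε σ 0
    have := intermediate_value_univ₂ (a := u - τ - ε) (b := u - τ + ε) hc (continuous_const (y := u))
      (by have := Real.neg_one_le_sin (2 * π * (u - τ - ε)); simp only [Gmap]; nlinarith)
      (by have := Real.sin_le_one (2 * π * (u - τ + ε)); simp only [Gmap]; nlinarith)
    exact this
  have hshift : ∀ u s, |s| ≤ σ/2 → ψ (u + s) = ψ u + s := by
    intro u s hs'
    obtain ⟨z, rfl⟩ := hsurj u
    rw [abs_le] at hs'
    have a1 := hcomm z (s/σ) ⟨by rw [le_div_iff₀ hσ]; linarith, by rw [div_le_iff₀ hσ]; linarith⟩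
    have a2 := hcomm z 0 (by norm_num)
    rw [Gmap_eq_zero_add, Gmap_eq_zero_add _ _ _ (s/σ) z, mul_div_cancel₀ _ hσ.ne', a2] at a1
    exact a1.symm
  have hshiftN : ∀ s, |s| ≤ σ/2 → ∀ N : ℕ, ψ (0 + N * s) = ψ 0 + N * s := by
    intro s hs' N
    induction N with
    | zero => simp
    | succ N ih =>
      have := hshift (0 + N * s) s hs'
      push_cast
      rw [show 0 + ((N:ℝ) + 1) * s = 0 + N * s + s by ring, this, ih]; ring
  have htrans : ∀ u, ψ u = ψ 0 + u := by
    intro u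
    obtain ⟨N, hN⟩ := exists_nat_gt (|u| / (σ/2))
    have hN0 : (0:ℝ) < N := lt_of_le_of_lt (by positivity) hN
    rw [div_lt_iff₀ (by linarith)] at hN
    have := hshiftN (u / N) (by
      rw [abs_div, abs_of_pos hN0, div_le_iff₀ hN0]; linarith) N
    rw [mul_div_cancel₀ _ hN0.ne', zero_add] at this
    exact this
  have hsin : ∀ z, Real.sin (2 * π * (ψ 0 + z)) = Real.sin (2 * π * z) := by
    intro z
    have := hcomm z 0 (by norm_num)
    rw [htrans, htrans (Gmap τ ε σ 0 z)] at this
    simp only [Gmap] at this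
    have : ε * (Real.sin (2 * π * (ψ 0 + z)) - Real.sin (2 * π * z)) = 0 := by linarith
    rcases mul_eq_zero.1 this with h | h
    · exact absurd h hε.ne'
    · linarith
  have hcos : Real.cos (2 * π * ψ 0) = 1 := by
    have := hsin (1/4)
    rw [show 2 * π * (ψ 0 + 1/4) = 2 * π * ψ 0 + π/2 by ring,
      show 2 * π * (1/4) = π/2 by ring, Real.sin_add_pi_div_two, Real.sin_pi_div_two] at this
    exact this
  obtain ⟨m, hm⟩ := (Real.cos_eq_one_iff _).1 hcos
  have hm' : ψ 0 = m := by
    have := Real.pi_pos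
    have h2 : 2 * π * ψ 0 = 2 * π * m := by linarith
    exact mul_left_cancel₀ (by positivity) h2
  have e := hψ1 0
  have e2 := hh.add_int 0 m
  rw [zero_add] at e2
  rw [hm', e2] at e
  have e3 : (m : ℝ) = d := by linarith
  rw [← e3] at h0 h1
  have i1 : 0 < m := by exact_mod_cast h0
  have i2 : m < 1 := by exact_mod_cast h1
  omega

lemma P_eq {P : Measure (ℤ → ℝ)} (hP : IsProductNuZ P) :
    P = Measure.infinitePi (fun _ : ℤ => nuI) := by
  have h1 := Measure.isProjectiveLimit_infinitePi (fun _ : ℤ => nuI)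
  have h2 : IsProjectiveLimit P (fun I : Finset ℤ => Measure.pi (fun _ : I => nuI)) := hP.2
  exact h2.unique h1

lemma P_eval {P : Measure (ℤ → ℝ)} (hP : IsProductNuZ P) (i : ℤ) :
    P.map (fun ω => ω i) = nuI := by
  rw [P_eq hP]
  exact Measure.infinitePi_map_eval (fun _ : ℤ => nuI) i

lemma P_mem {P : Measure (ℤ → ℝ)} (hP : IsProductNuZ P) :
    ∀ᵐ ω ∂P, ∀ i, ω i ∈ Icc (-(1/2) : ℝ) (1/2) := by
  rw [ae_all_iff]
  intro i
  have h1 : ∀ᵐ w ∂nuI, w ∈ Icc (-(1/2) : ℝ) (1/2) := ae_restrict_mem measurableSet_Icc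
  rw [← P_eval hP i] at h1
  exact ae_of_ae_map (measurable_pi_apply i).aemeasurable h1

/-- past coordinates -/
def Upast (n : ℕ) (ω : ℤ → ℝ) : (Finset.Ico (0:ℤ) n) → ℝ := fun i => ω i

lemma coord_meas {n : ℕ} {i : ℤ} (hi : i ∈ Finset.Ico (0:ℤ) n) :
    Measurable[MeasurableSpace.comap (Upast n) inferInstance] (fun ω : ℤ → ℝ => ω i) := by
  have : (fun ω : ℤ → ℝ => ω i) = (fun u : (Finset.Ico (0:ℤ) n) → ℝ => u ⟨i, hi⟩) ∘ Upast n := rfl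
  rw [this]
  exact (measurable_pi_apply _).comp (comap_measurable (Upast n))

/-- the filtration of the past -/
def Fil : Filtration ℕ (inferInstance : MeasurableSpace (ℤ → ℝ)) where
  seq n := MeasurableSpace.comap (Upast n) inferInstance
  mono' := by
    intro n m hnm
    refine Measurable.comap_le ?_
    refine @measurable_pi_lambda _ _ _ (_) _ _ (fun i => ?_)
    apply coord_meas (n := m)
    have := Finset.mem_Ico.1 i.2
    rw [Finset.mem_Ico]
    constructor
    · exact this.1
    · have h2 := this.2
      have : (n:ℤ) ≤ m := by exact_mod_cast hnm
      linarith
  le' := by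
    intro n
    refine Measurable.comap_le ?_
    exact measurable_pi_lambda _ (fun i => measurable_pi_apply _)

lemma Fil_indep {P : Measure (ℤ → ℝ)} (hP : IsProductNuZ P) (n : ℕ) :
    ProbabilityTheory.IndepFun (Upast n) (fun ω : ℤ → ℝ => ω n) P := by
  have h1 : ProbabilityTheory.iIndepFun (fun (i : ℤ) (ω : ℤ → ℝ) => ω i) P := by
    rw [P_eq hP]
    exact ProbabilityTheory.iIndepFun_infinitePi (P := fun _ : ℤ => nuI) (X := fun _ w => w)
      (fun i => measurable_id)
  have h2 := h1.indepFun_finset (Finset.Ico (0:ℤ) n) {(n:ℤ)} (by simp)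
    (fun i => measurable_pi_apply i)
  exact h2.comp (φ := id) (ψ := fun u : (({(n:ℤ)} : Finset ℤ) → ℝ) => u ⟨n, by simp⟩)
    measurable_id (measurable_pi_apply _)

lemma freeze {P : Measure (ℤ → ℝ)} (hP : IsProductNuZ P) (n : ℕ) {E : Type} [mE : MeasurableSpace E]
    {Z : (ℤ → ℝ) → E} (hZ : Measurable[Fil n] Z) {φ : E × ℝ → ℝ} (hφ : Measurable φ)
    (hint : Integrable (fun ω => φ (Z ω, ω n)) P) :
    ∫ ω, φ (Z ω, ω n) ∂P = ∫ ω, (∫ w, φ (Z ω, w) ∂nuI) ∂P := by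
  have := hP.1
  have hZ' : Measurable Z := hZ.mono (Fil.le n) le_rfl
  have hind : ProbabilityTheory.IndepFun Z (fun ω : ℤ → ℝ => ω n) P := by
    have h := Fil_indep hP n
    rw [ProbabilityTheory.IndepFun_iff_Indep] at h ⊢
    exact ProbabilityTheory.indep_of_indep_of_le_left h hZ.comap_le
  have hmap := (ProbabilityTheory.indepFun_iff_map_prod_eq_prod_map_map hZ'.aemeasurable
    (measurable_pi_apply (n:ℤ)).aemeasurable).1 hind
  rw [P_eval hP] at hmap
  have hm : Measurable (fun ω : ℤ → ℝ => (Z ω, ω n)) := hZ'.prodMk (measurable_pi_apply _)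
  have : IsProbabilityMeasure (P.map Z) := Measure.isProbabilityMeasure_map hZ'.aemeasurable
  have hint' : Integrable φ ((P.map Z).prod nuI) := by
    rw [← hmap, integrable_map_measure hφ.aestronglyMeasurable hm.aemeasurable]
    exact hint
  calc ∫ ω, φ (Z ω, ω n) ∂P = ∫ q, φ q ∂((P.map Z).prod nuI) := by
        rw [← hmap, integral_map hm.aemeasurable hφ.aestronglyMeasurable]
    _ = ∫ z, (∫ w, φ (z, w) ∂nuI) ∂(P.map Z) := integral_prod _ hint'
    _ = _ := by
        rw [integral_map hZ'.aemeasurable]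
        exact hφ.stronglyMeasurable.integral_prod_right'.aestronglyMeasurable

lemma Gn_meas (τ ε σ x : ℝ) (n : ℕ) : Measurable[Fil n] (fun ω => Gn τ ε σ ω n x) := by
  induction n with
  | zero => exact measurable_const
  | succ n ih =>
    have h1 : Measurable[Fil (n+1)] (fun ω : ℤ → ℝ => ω n) := coord_meas (by simp)
    have h2 : Measurable[Fil (n+1)] (fun ω => Gn τ ε σ ω n x) :=
      ih.mono (Fil.mono (Nat.le_succ n)) le_rfl
    exact (Gmap_cont τ ε σ).measurable.comp (h1.prodMk h2)

/-- the strip -/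
def strip : Set (ℝ × ℝ) := {p | p.1 ≤ p.2 ∧ p.2 ≤ p.1 + 1}

lemma strip_step {τ σ ε : ℝ} (hε : 0 < ε) (hεπ : 2 * π * ε < 1) {p : ℝ × ℝ} (hp : p ∈ strip) (w : ℝ) :
    (Gmap τ ε σ w p.1, Gmap τ ε σ w p.2) ∈ strip := by
  have hm := (Gmap_strictMono τ σ w hε hεπ).monotone
  refine ⟨hm hp.1, ?_⟩
  simp only []
  rw [← Gmap_add_one]
  exact hm hp.2

lemma strip_orbit {τ σ ε : ℝ} (hε : 0 < ε) (hεπ : 2 * π * ε < 1) {x y : ℝ} (hp : (x, y) ∈ strip)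
    (ω : ℤ → ℝ) (n : ℕ) : (Gn τ ε σ ω n x, Gn τ ε σ ω n y) ∈ strip := by
  induction n with
  | zero => exact hp
  | succ n ih => exact strip_step hε hεπ ih _

lemma D_strip {h : ℝ → ℝ} (hh : Deg1 h) {p : ℝ × ℝ} (hp : p ∈ strip) :
    0 ≤ h p.2 - h p.1 ∧ h p.2 - h p.1 ≤ 1 := by
  have h1 := hh.mono hp.1
  have h2 := hh.mono hp.2
  rw [hh.add_one] at h2
  constructor <;> linarith

lemma Vf_le {τ σ ε : ℝ} (hε : 0 < ε) (hεπ : 2 * π * ε < 1) {h : ℝ → ℝ} (hh : Deg1 h)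
    {p : ℝ × ℝ} (hp : p ∈ strip) : Vf τ ε σ h p ≤ 1 := by
  have hc : Continuous (fun w => ((h (Gmap τ ε σ w p.2) - h (Gmap τ ε σ w p.1))
      - (h p.2 - h p.1)) ^ 2) := by
    have := hh.cont
    unfold Gmap; fun_prop
  have := integral_mono (μ := nuI) (g := fun _ => (1:ℝ)) (integrable_nuI hc) (integrable_const _)
    (fun w => by
      have h1 := D_strip hh hp
      have h2 := D_strip hh (strip_step (τ := τ) (σ := σ) hε hεπ hp w)
      simp only [] at h2 ⊢
      rw [sq_le_one_iff_abs_le_one, abs_le]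
      constructor <;> linarith)
  simpa [Vf] using this

lemma SopV_le {τ σ ε : ℝ} (hε : 0 < ε) (hεπ : 2 * π * ε < 1) {h : ℝ → ℝ} (hh : Deg1 h) (k : ℕ)
    {p : ℝ × ℝ} (hp : p ∈ strip) : (Sop τ ε σ)^[k] (Vf τ ε σ h) p ≤ 1 := by
  induction k generalizing p with
  | zero => exact Vf_le hε hεπ hh hp
  | succ k ih =>
    rw [iterate_succ_apply']
    have := integral_mono (μ := nuI) (g := fun _ => (1:ℝ))
      (integrable_nuI ((SopV_cont (τ := τ) (ε := ε) (σ := σ) hh.cont k).comp (pair_cont_w τ ε σ p)))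
      (integrable_const _) (fun w => ih (strip_step hε hεπ hp w))
    simpa [Sop] using this

lemma D_mean {τ σ ε c : ℝ} {h : ℝ → ℝ} (hh : Deg1 h) (hT : ∀ x, avT τ ε σ h x = h x + c) (x y : ℝ) :
    ∫ w, (h (Gmap τ ε σ w y) - h (Gmap τ ε σ w x)) ∂nuI = h y - h x := by
  have hi : ∀ x, Integrable (fun w => h (Gmap τ ε σ w x)) nuI := fun x =>
    integrable_nuI (hh.cont.comp (Gmap_cont_w τ ε σ x))
  rw [integral_sub (hi y) (hi x)]
  have h1 := hT x
  have h2 := hT y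
  unfold avT at h1 h2
  rw [h1, h2]; ring

lemma D_sq {τ σ ε c : ℝ} {h : ℝ → ℝ} (hh : Deg1 h) (hT : ∀ x, avT τ ε σ h x = h x + c) (x y : ℝ) :
    ∫ w, (h (Gmap τ ε σ w y) - h (Gmap τ ε σ w x)) ^ 2 ∂nuI =
      (h y - h x) ^ 2 + Vf τ ε σ h (x, y) := by
  have hc := hh.cont
  have c1 : Continuous (fun w => (h (Gmap τ ε σ w y) - h (Gmap τ ε σ w x))) := by
    unfold Gmap; fun_prop
  have i0 : Integrable (fun w => (h (Gmap τ ε σ w y) - h (Gmap τ ε σ w x)) ^ 2) nuI :=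
    integrable_nuI (c1.pow 2)
  have i1 : Integrable (fun w => 2 * (h y - h x) * (h (Gmap τ ε σ w y) - h (Gmap τ ε σ w x))) nuI :=
    integrable_nuI (continuous_const.mul c1)
  have i01 : Integrable (fun w => (h (Gmap τ ε σ w y) - h (Gmap τ ε σ w x)) ^ 2
      - 2 * (h y - h x) * (h (Gmap τ ε σ w y) - h (Gmap τ ε σ w x))) nuI := i0.sub i1
  have hm := D_mean hh hT x y
  have hV : Vf τ ε σ h (x, y) = ∫ w, ((h (Gmap τ ε σ w y) - h (Gmap τ ε σ w x)) ^ 2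
      - 2 * (h y - h x) * (h (Gmap τ ε σ w y) - h (Gmap τ ε σ w x)) + (h y - h x) ^ 2) ∂nuI := by
    unfold Vf
    congr 1
    funext w
    ring
  rw [hV, integral_add i01 (integrable_const _), integral_sub i0 i1, integral_const_mul, hm]
  simp
  ring

lemma ae_zero_of_sum {Ω : Type*} [MeasurableSpace Ω] {μ : Measure Ω} {f : ℕ → Ω → ℝ}
    (h0 : ∀ n ω, 0 ≤ f n ω) (hi : ∀ n, Integrable (f n) μ)
    (hs : ∀ N, ∑ n ∈ Finset.range N, ∫ ω, f n ω ∂μ ≤ 1) :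
    ∀ᵐ ω ∂μ, Tendsto (fun n => f n ω) atTop (nhds 0) := by
  have hsum : Summable (fun n => ∫ ω, f n ω ∂μ) :=
    summable_of_sum_range_le (fun n => integral_nonneg (h0 n)) hs
  have hl : ∫⁻ ω, ∑' n, ENNReal.ofReal (f n ω) ∂μ ≠ ⊤ := by
    rw [lintegral_tsum (fun n => (hi n).aestronglyMeasurable.aemeasurable.ennreal_ofReal)]
    have : ∀ n, ∫⁻ ω, ENNReal.ofReal (f n ω) ∂μ = ENNReal.ofReal (∫ ω, f n ω ∂μ) := fun n =>
      (ofReal_integral_eq_lintegral_ofReal (hi n) (Eventually.of_forall (h0 n))).symm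
    simp_rw [this]
    rw [← ENNReal.ofReal_tsum_of_nonneg (fun n => integral_nonneg (h0 n)) hsum]
    exact ENNReal.ofReal_ne_top
  have hm : AEMeasurable (fun ω => ∑' n, ENNReal.ofReal (f n ω)) μ :=
    AEMeasurable.tsum (fun n => (hi n).aestronglyMeasurable.aemeasurable.ennreal_ofReal)
  filter_upwards [ae_lt_top' hm hl] with ω hω
  have h1 := ENNReal.tendsto_atTop_zero_of_tsum_ne_top hω.ne
  have h2 := (ENNReal.tendsto_toReal ENNReal.zero_ne_top).comp h1
  simpa [comp_def, ENNReal.toReal_ofReal (h0 _ _)] using h2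

lemma pair_limits {P : Measure (ℤ → ℝ)} (hP : IsProductNuZ P) {τ σ ε c : ℝ} (hε : 0 < ε)
    (hεπ : 2 * π * ε < 1) {h : ℝ → ℝ} (hh : Deg1 h) (hT : ∀ x, avT τ ε σ h x = h x + c)
    {x y : ℝ} (hp : (x, y) ∈ strip) :
    ∀ᵐ ω ∂P, (∃ d, Tendsto (fun n => h (Gn τ ε σ ω n y) - h (Gn τ ε σ ω n x)) atTop (nhds d)) ∧
      ∀ k, Tendsto (fun n => (Sop τ ε σ)^[k] (Vf τ ε σ h) (Gn τ ε σ ω n x, Gn τ ε σ ω n y))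
        atTop (nhds 0) := by
  have := hP.1
  have hhm : Measurable h := hh.cont.measurable
  have hGm : ∀ n z, Measurable (fun ω => Gn τ ε σ ω n z) := fun n z =>
    (Gn_meas τ ε σ z n).mono (Fil.le n) le_rfl
  have hpm : ∀ n, Measurable[Fil n] (fun ω => (Gn τ ε σ ω n x, Gn τ ε σ ω n y)) := fun n =>
    (Gn_meas τ ε σ x n).prodMk (Gn_meas τ ε σ y n)
  have hpm' : ∀ n, Measurable (fun ω => (Gn τ ε σ ω n x, Gn τ ε σ ω n y)) := fun n =>
    (hpm n).mono (Fil.le n) le_rfl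
  have hDb : ∀ n ω, ‖h (Gn τ ε σ ω n y) - h (Gn τ ε σ ω n x)‖ ≤ 1 := by
    intro n ω
    have := D_strip hh (strip_orbit (τ := τ) (σ := σ) hε hεπ hp ω n)
    rw [Real.norm_eq_abs, abs_le]
    constructor <;> linarith [this.1, this.2]
  have hDi : ∀ n, Integrable (fun ω => h (Gn τ ε σ ω n y) - h (Gn τ ε σ ω n x)) P := fun n =>
    Integrable.of_bound ((hhm.comp (hGm n y)).sub (hhm.comp (hGm n x))).aestronglyMeasurable 1
      (Eventually.of_forall (hDb n))
  have hD2i : ∀ n, Integrable (fun ω => (h (Gn τ ε σ ω n y) - h (Gn τ ε σ ω n x)) ^ 2) P := fun n =>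
    Integrable.of_bound (((hhm.comp (hGm n y)).sub (hhm.comp (hGm n x))).pow_const 2).aestronglyMeasurable 1
      (Eventually.of_forall (fun ω => by
        rw [norm_pow]; exact pow_le_one₀ (norm_nonneg _) (hDb n ω)))
  have hVi : ∀ k n, Integrable (fun ω =>
      (Sop τ ε σ)^[k] (Vf τ ε σ h) (Gn τ ε σ ω n x, Gn τ ε σ ω n y)) P := fun k n =>
    Integrable.of_bound ((SopV_cont hh.cont k).measurable.comp (hpm' n)).aestronglyMeasurable 1
      (Eventually.of_forall (fun ω => by
        rw [Real.norm_eq_abs, abs_of_nonneg (SopV_nonneg k _)]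
        exact SopV_le hε hεπ hh k (strip_orbit hε hεπ hp ω n)))
  have hmart : Martingale (fun n ω => h (Gn τ ε σ ω n y) - h (Gn τ ε σ ω n x)) Fil P := by
    refine martingale_of_setIntegral_eq_succ ?_ hDi ?_
    · intro n
      exact ((hhm.comp (Gn_meas τ ε σ y n)).sub (hhm.comp (Gn_meas τ ε σ x n))).stronglyMeasurable
    · intro n s hs
      have hs' : MeasurableSet s := Fil.le n s hs
      have hZ : Measurable[Fil n] (fun ω => (s.indicator (fun _ => (1:ℝ)) ω,
          (Gn τ ε σ ω n x, Gn τ ε σ ω n y))) :=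
        (measurable_const.indicator hs).prodMk (hpm n)
      have hφ : Measurable (fun q : (ℝ × (ℝ × ℝ)) × ℝ =>
          q.1.1 * (h (Gmap τ ε σ q.2 q.1.2.2) - h (Gmap τ ε σ q.2 q.1.2.1))) := by
        have hc := hh.cont
        apply Continuous.measurable
        unfold Gmap; fun_prop
      have e : ∀ f : (ℤ → ℝ) → ℝ, ∫ ω in s, f ω ∂P =
          ∫ ω, s.indicator (fun _ => (1:ℝ)) ω * f ω ∂P := by
        intro f
        rw [← integral_indicator hs']
        congr 1; funext ω
        by_cases hω : ω ∈ s <;> simp [hω]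
      have hint : Integrable (fun ω => s.indicator (fun _ => (1:ℝ)) ω *
          (h (Gn τ ε σ ω (n+1) y) - h (Gn τ ε σ ω (n+1) x))) P := by
        have := (hDi (n+1)).indicator hs'
        refine this.congr (Eventually.of_forall (fun ω => ?_))
        by_cases hω : ω ∈ s <;> simp [hω]
      have := freeze hP n hZ hφ hint
      rw [e, e]
      refine Eq.trans ?_ this.symm
      congr 1; funext ω
      simp only []
      rw [integral_const_mul, D_mean hh hT]
  have hbdd : ∀ n, eLpNorm (fun ω => h (Gn τ ε σ ω n y) - h (Gn τ ε σ ω n x)) 1 P ≤ (1 : NNReal) := by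
    intro n
    refine (eLpNorm_le_of_ae_bound (Eventually.of_forall (hDb n))).trans ?_
    simp
  have hconv := hmart.submartingale.exists_ae_tendsto_of_bdd hbdd
  -- second moments
  let a : ℕ → ℝ := fun n => ∫ ω, (h (Gn τ ε σ ω n y) - h (Gn τ ε σ ω n x)) ^ 2 ∂P
  have ha0 : ∀ n, 0 ≤ a n := fun n => integral_nonneg (fun ω => sq_nonneg _)
  have ha1 : ∀ n, a n ≤ 1 := by
    intro n
    have := integral_mono (hD2i n) (integrable_const (μ := P) (1:ℝ)) (fun ω => by
      have := pow_le_one₀ (n := 2) (norm_nonneg _) (hDb n ω)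
      rwa [Real.norm_eq_abs, sq_abs] at this)
    simpa using this
  have hsucc : ∀ n, ∫ ω, Vf τ ε σ h (Gn τ ε σ ω n x, Gn τ ε σ ω n y) ∂P = a (n+1) - a n := by
    intro n
    have hφ : Measurable (fun q : (ℝ × ℝ) × ℝ =>
        (h (Gmap τ ε σ q.2 q.1.2) - h (Gmap τ ε σ q.2 q.1.1)) ^ 2) := by
      have hc := hh.cont
      apply Continuous.measurable
      unfold Gmap; fun_prop
    have := freeze hP n (hpm n) hφ (hD2i (n+1))
    simp only [D_sq hh hT] at this
    have hV0 : Integrable (fun ω => Vf τ ε σ h (Gn τ ε σ ω n x, Gn τ ε σ ω n y)) P := hVi 0 n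
    rw [integral_add (hD2i n) hV0] at this
    have e : a (n+1) = a n + ∫ ω, Vf τ ε σ h (Gn τ ε σ ω n x, Gn τ ε σ ω n y) ∂P := this
    linarith
  have hk : ∀ k n, ∫ ω, (Sop τ ε σ)^[k] (Vf τ ε σ h) (Gn τ ε σ ω n x, Gn τ ε σ ω n y) ∂P
      = a (n+k+1) - a (n+k) := by
    intro k
    induction k with
    | zero => exact hsucc
    | succ k ih =>
      intro n
      have hφ : Measurable (fun q : (ℝ × ℝ) × ℝ =>
          (Sop τ ε σ)^[k] (Vf τ ε σ h) (Gmap τ ε σ q.2 q.1.1, Gmap τ ε σ q.2 q.1.2)) :=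
        ((SopV_cont hh.cont k).comp (pair_cont τ ε σ)).measurable
      have := freeze hP n (hpm n) hφ (hVi k (n+1))
      rw [iterate_succ_apply']
      have e := ih (n+1)
      rw [show n + 1 + k = n + (k+1) by ring] at e
      rw [← e]
      exact this.symm
  have hzero : ∀ k, ∀ᵐ ω ∂P, Tendsto (fun n =>
      (Sop τ ε σ)^[k] (Vf τ ε σ h) (Gn τ ε σ ω n x, Gn τ ε σ ω n y)) atTop (nhds 0) := by
    intro k
    refine ae_zero_of_sum (fun n ω => SopV_nonneg k _) (hVi k) (fun N => ?_)
    simp_rw [hk]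
    have := Finset.sum_range_sub (fun n => a (n + k)) N
    have e : ∀ n, a (n + k + 1) = a (n + 1 + k) := fun n => by congr 1; ring
    simp_rw [e]
    rw [this]
    linarith [ha1 (N+k), ha0 (0+k)]
  rw [← ae_all_iff] at hzero
  filter_upwards [hconv, hzero] with ω h1 h2
  exact ⟨h1, h2⟩

lemma Gmap_add_int (τ ε σ w x : ℝ) (m : ℤ) : Gmap τ ε σ w (x + m) = Gmap τ ε σ w x + m := by
  unfold Gmap
  have : Real.sin (2 * π * (x + m)) = Real.sin (2 * π * x) := by
    rw [show 2 * π * (x + m) = 2 * π * x + m * (2 * π) by ring, Real.sin_add_int_mul_two_pi]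
  rw [this]; ring

lemma SopV_add_int {τ ε σ : ℝ} {h : ℝ → ℝ} (hh : Deg1 h) (k : ℕ) (x y : ℝ) (m : ℤ) :
    (Sop τ ε σ)^[k] (Vf τ ε σ h) (x + m, y + m) = (Sop τ ε σ)^[k] (Vf τ ε σ h) (x, y) := by
  induction k generalizing x y with
  | zero =>
    simp only [iterate_zero, id, Vf, Gmap_add_int, hh.add_int]
    congr 1; funext w; ring
  | succ k ih =>
    rw [iterate_succ_apply']
    simp only [Sop, Gmap_add_int, ih]

lemma limit_dichotomy {τ σ ε : ℝ} (hε : 0 < ε) (hεπ : 2 * π * ε < 1) (hσ : 0 < σ)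
    (hgap : ∀ a, ∃ n, Gn τ ε σ (fun _ => -(1/2)) n a + 1 ≤ Gn τ ε σ (fun _ => 1/2) n a)
    {h : ℝ → ℝ} (hh : Deg1 h) (hs : StrictMono h) {X Y : ℕ → ℝ}
    (hst : ∀ n, (X n, Y n) ∈ strip) {d : ℝ}
    (hd : Tendsto (fun n => h (Y n) - h (X n)) atTop (nhds d))
    (hk : ∀ k, Tendsto (fun n => (Sop τ ε σ)^[k] (Vf τ ε σ h) (X n, Y n)) atTop (nhds 0)) :
    d = 0 ∨ d = 1 := by
  have d0 : 0 ≤ d := ge_of_tendsto' hd (fun n => (D_strip hh (hst n)).1)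
  have d1 : d ≤ 1 := le_of_tendsto' hd (fun n => (D_strip hh (hst n)).2)
  by_contra! hcon
  let q : ℕ → ℝ × ℝ := fun n => (X n + ((-⌊X n⌋ : ℤ) : ℝ), Y n + ((-⌊X n⌋ : ℤ) : ℝ))
  have hq : ∀ n, q n ∈ Icc (0:ℝ) 1 ×ˢ Icc (0:ℝ) 2 := by
    intro n
    have a := Int.floor_le (X n)
    have b := Int.lt_floor_add_one (X n)
    have c := (hst n).1
    have e := (hst n).2
    simp only [] at c e
    simp only [q, Int.cast_neg, mem_prod, mem_Icc]
    refine ⟨⟨?_, ?_⟩, ?_, ?_⟩ <;> linarith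
  obtain ⟨p, -, φ, hφ, hlim⟩ := (isCompact_Icc.prod isCompact_Icc).tendsto_subseq hq
  have hc := hh.cont
  have hD : h p.2 - h p.1 = d := by
    have e1 : Tendsto (fun n => h (q (φ n)).2 - h (q (φ n)).1) atTop (nhds (h p.2 - h p.1)) :=
      ((by fun_prop : Continuous (fun r : ℝ × ℝ => h r.2 - h r.1)).tendsto p).comp hlim
    have e2 := hd.comp hφ.tendsto_atTop
    refine tendsto_nhds_unique e1 (e2.congr (fun n => ?_))
    simp only [q, comp_apply, hh.add_int]; ring
  have hz : ∀ k, (Sop τ ε σ)^[k] (Vf τ ε σ h) (p.1, p.2) = 0 := by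
    intro k
    have e1 := ((SopV_cont (τ := τ) (ε := ε) (σ := σ) hc k).tendsto p).comp hlim
    have e2 := (hk k).comp hφ.tendsto_atTop
    refine tendsto_nhds_unique e1 (e2.congr (fun n => ?_))
    simp only [q, comp_apply, SopV_add_int hh]
  refine rigidity hε hεπ hσ hgap hh hs hz ?_ ?_
  · rw [hD]; exact lt_of_le_of_ne d0 (Ne.symm hcon.1)
  · rw [hD]; exact lt_of_le_of_ne d1 hcon.2

lemma modulus {h : ℝ → ℝ} (hh : Deg1 h) (hs : StrictMono h) {δ : ℝ} (hδ : 0 < δ) :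
    ∃ η > 0, ∀ x, η ≤ h (x + δ) - h x := by
  have hc := hh.cont
  obtain ⟨x0, -, h0⟩ := isCompact_Icc.exists_isMinOn (s := Icc (0:ℝ) 1) ⟨0, by simp⟩
    (f := fun x => h (x + δ) - h x) (by fun_prop)
  refine ⟨h (x0 + δ) - h x0, sub_pos.2 (hs (by linarith)), fun x => ?_⟩
  have h1 := h0 (show x + ((-⌊x⌋ : ℤ) : ℝ) ∈ Icc (0:ℝ) 1 by
    have a := Int.floor_le x
    have b := Int.lt_floor_add_one x
    rw [Int.cast_neg]
    constructor <;> linarith)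
  have e : x + ((-⌊x⌋ : ℤ) : ℝ) + δ = (x + δ) + ((-⌊x⌋ : ℤ) : ℝ) := by ring
  simp only [mem_ofPred_eq, e, hh.add_int] at h1
  linarith

lemma circle_dist_le (a b : ℝ) : dist (a : AddCircle (1:ℝ)) (b : AddCircle (1:ℝ)) ≤ |a - b| := by
  rw [dist_eq_norm, ← AddCircle.coe_sub]
  exact QuotientAddGroup.norm_mk_le_norm

lemma dist_tendsto {h : ℝ → ℝ} (hh : Deg1 h) (hs : StrictMono h) {X Y : ℕ → ℝ}
    (hst : ∀ n, (X n, Y n) ∈ strip) {d : ℝ}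
    (hd : Tendsto (fun n => h (Y n) - h (X n)) atTop (nhds d)) (h01 : d = 0 ∨ d = 1) :
    Tendsto (fun n => dist (X n : AddCircle (1:ℝ)) (Y n : AddCircle (1:ℝ))) atTop (nhds 0) := by
  rw [Metric.tendsto_atTop]
  intro δ hδ
  obtain ⟨η, hη, hm⟩ := modulus hh hs hδ
  obtain ⟨N, hN⟩ := Metric.tendsto_atTop.1 hd η hη
  refine ⟨N, fun n hn => ?_⟩
  have h1 := hN n hn
  rw [Real.dist_eq, abs_lt] at h1
  rw [Real.dist_eq, sub_zero, abs_of_nonneg dist_nonneg]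
  have c := (hst n).1
  have e := (hst n).2
  simp only [] at c e
  rcases h01 with rfl | rfl
  · refine (circle_dist_le _ _).trans_lt ?_
    have : Y n < X n + δ := hs.lt_iff_lt.1 (by linarith [hm (X n)])
    rw [abs_lt]; constructor <;> linarith
  · have : X n + 1 < Y n + δ := hs.lt_iff_lt.1 (by rw [hh.add_one]; linarith [hm (Y n)])
    have e1 : ((X n : ℝ) : AddCircle (1:ℝ)) = ((X n + 1 : ℝ) : AddCircle (1:ℝ)) :=
      (AddCircle.coe_add_period 1 (X n)).symm
    rw [e1]
    refine (circle_dist_le _ _).trans_lt ?_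
    rw [abs_lt]; constructor <;> linarith

lemma phiN_coe (τ ε σ : ℝ) (ω : ℤ → ℝ) (n : ℕ) (x : ℝ) :
    phiN τ ε σ ω n (x : AddCircle (1:ℝ)) = ((Gn τ ε σ ω n x : ℝ) : AddCircle (1:ℝ)) := by
  induction n with
  | zero => rfl
  | succ n ih =>
    simp only [phiN, Gn, comp_apply, ih, Fmap, Gmap]
    rw [show sinA ((Gn τ ε σ ω n x : ℝ) : AddCircle (1:ℝ)) = Real.sin (2 * π * Gn τ ε σ ω n x) from
      sin2_periodic.lift_coe _, ← AddCircle.coe_add]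
    congr 1; ring

lemma sinA_cont : Continuous sinA := by
  have : Continuous (fun x : ℝ => Real.sin (2 * π * x)) := by fun_prop
  exact continuous_quot_lift _ this

lemma Fmap_meas (τ ε σ : ℝ) :
    Measurable (fun q : ℝ × AddCircle (1:ℝ) => Fmap τ ε σ q.1 q.2) := by
  apply Continuous.measurable
  have := sinA_cont
  have h2 : Continuous (fun x : ℝ => (x : AddCircle (1:ℝ))) := AddCircle.continuous_mk' 1
  unfold Fmap
  exact continuous_snd.add (h2.comp (by fun_prop))

lemma phiN_meas (τ ε σ : ℝ) (n : ℕ) :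
    Measurable (fun q : (ℤ → ℝ) × AddCircle (1:ℝ) => phiN τ ε σ q.1 n q.2) := by
  induction n with
  | zero => exact measurable_snd
  | succ n ih =>
    exact (Fmap_meas τ ε σ).comp (((measurable_pi_apply (n:ℤ)).comp measurable_fst).prodMk ih)

/-- **Synchronization by noise:** if the random rotation number `ρ` is irrational, then
for `P`-a.e. `ω` and Lebesgue-a.e. pair `(x,y)` on the torus `(ℝ/ℤ)²`, the forward
trajectories driven by the same noise realization synchronize:
`dist(φ(n,ω)(x), φ(n,ω)(y)) → 0`. -/
theorem noisy_circle_map_synchronization (τ ε σ : ℝ)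
    (hε : 0 < ε) (hεπ : 2 * π * ε < 1) (hσ : 0 < σ)
    (P : Measure (ℤ → ℝ)) (hP : IsProductNuZ P)
    (ρ : ℝ)
    (hρ : ∀ᵐ ω ∂P, ∀ x : ℝ,
      Tendsto (fun n : ℕ => (Gn τ ε σ ω n x - x) / n) atTop (nhds ρ))
    (hirr : Irrational ρ) :
    ∀ᵐ ω ∂P,
      ∀ᵐ p ∂((volume : Measure (AddCircle (1:ℝ))).prod (volume : Measure (AddCircle (1:ℝ)))),
        Tendsto (fun n : ℕ => dist (phiN τ ε σ ω n p.1) (phiN τ ε σ ω n p.2))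
          atTop (nhds 0) := by
  have := hP.1
  obtain ⟨ω0, hω0, hρ0⟩ := ((P_mem hP).and hρ).exists
  have hgap := gap_lemma hε hεπ hσ hirr ω0 hω0 hρ0
  obtain ⟨h, c, hh, hT⟩ := exists_h (τ := τ) hε hεπ hσ
  have hs := h_strictMono hε hεπ hσ hgap hh hT
  have key : ∀ p : AddCircle (1:ℝ) × AddCircle (1:ℝ), ∀ᵐ ω ∂P,
      Tendsto (fun n : ℕ => dist (phiN τ ε σ ω n p.1) (phiN τ ε σ ω n p.2)) atTop (nhds 0) := by
    rintro ⟨a, b⟩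
    obtain ⟨x, rfl⟩ := QuotientAddGroup.mk_surjective a
    obtain ⟨y, rfl⟩ := QuotientAddGroup.mk_surjective b
    have hy : ((y : ℝ) : AddCircle (1:ℝ)) = ((y - ⌊y - x⌋ : ℝ) : AddCircle (1:ℝ)) := by
      have : ((⌊y - x⌋ : ℝ) : AddCircle (1:ℝ)) = 0 := by
        rw [AddCircle.coe_eq_zero_iff]
        exact ⟨⌊y - x⌋, by simp⟩
      rw [AddCircle.coe_sub, this, sub_zero]
    have hp : (x, y - ⌊y - x⌋) ∈ strip := by
      have a := Int.floor_le (y - x)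
      have b := Int.lt_floor_add_one (y - x)
      constructor <;> simp only [] <;> linarith
    filter_upwards [pair_limits hP hε hεπ hh hT hp] with ω hω
    obtain ⟨⟨d, hd⟩, hk⟩ := hω
    have hst := strip_orbit (τ := τ) (σ := σ) hε hεπ hp ω
    have := dist_tendsto hh hs hst hd (limit_dichotomy hε hεπ hσ hgap hh hs hst hd hk)
    change Tendsto (fun n : ℕ => dist (phiN τ ε σ ω n (x : AddCircle (1:ℝ)))
      (phiN τ ε σ ω n (y : AddCircle (1:ℝ)))) atTop (nhds 0)
    rw [hy]
    simpa only [phiN_coe] using this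
  have hmeas : MeasurableSet {q : (ℤ → ℝ) × (AddCircle (1:ℝ) × AddCircle (1:ℝ)) |
      Tendsto (fun n : ℕ => dist (phiN τ ε σ q.1 n q.2.1) (phiN τ ε σ q.1 n q.2.2))
        atTop (nhds 0)} := by
    refine measurableSet_tendsto (nhds 0) (fun n => ?_)
    exact ((phiN_meas τ ε σ n).comp (measurable_fst.prodMk (measurable_fst.comp measurable_snd))).dist
      ((phiN_meas τ ε σ n).comp (measurable_fst.prodMk (measurable_snd.comp measurable_snd)))
  exact (Measure.ae_ae_comm hmeas).2 (Eventually.of_forall key)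
end
end

section
/- Let Φ_A and Φ_B be two one-dimensional linear hyperbolic cocycles over the same ergodic, invertible, measure-preserving transformation θ of a probability space (Ω, 𝔉, P). Then Φ_A and Φ_B are topologically conjugate if and only if the following two conditions both hold: (i) the Lyapunov exponents λ_A = ∫ log|A| dP and λ_B = ∫ log|B| dP have the same sign; and (ii) the set C_{AB} := {ω ∈ Ω : sign(A(ω)) · sign(B(ω)) = −1} is a coboundary. -/
open MeasureTheory Real Filter Set Function

noncomputable section

variable {Ω : Type*} [MeasurableSpace Ω]

/-- The finite products `A(θ^{n−1}ω) ⋯ A(ω)` generating a linear cocycle. -/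
def prodA (A : Ω → ℝ) (θ : Ω → Ω) : ℕ → Ω → ℝ
  | 0 => fun _ => 1
  | n + 1 => fun ω => A (θ^[n] ω) * prodA A θ n ω

/-- `θ^n` for `n : ℤ`, for an invertible transformation `θ`. -/
def iterZ (θ : Ω ≃ᵐ Ω) (n : ℤ) (ω : Ω) : Ω :=
  if 0 ≤ n then (⇑θ)^[n.toNat] ω else (⇑θ.symm)^[(-n).toNat] ω

/-- The one-dimensional linear cocycle `Φ_A(n,ω)` over the invertible transformation `θ`:
`Φ_A(n,ω) = A(θ^{n−1}ω) ⋯ A(ω)` for `n ≥ 0` and `Φ_A(n,ω) = (Φ_A(−n, θ^n ω))⁻¹` for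
`n ≤ −1`. -/
def PhiLin (A : Ω → ℝ) (θ : Ω ≃ᵐ Ω) (n : ℤ) (ω : Ω) : ℝ :=
  if 0 ≤ n then prodA A (⇑θ) n.toNat ω
  else (prodA A (⇑θ) (-n).toNat (iterZ θ n ω))⁻¹

/-- Topological conjugacy of two one-dimensional linear cocycles: a measurable random
homeomorphism `h(ω)` of `ℝ` fixing `0` intertwining the two cocycles. -/
def LinConjugate (P : Measure Ω) (θ : Ω ≃ᵐ Ω) (A B : Ω → ℝ) : Prop :=
  ∃ h : Ω → Homeomorph ℝ ℝ,
    Measurable (fun p : Ω × ℝ => h p.1 p.2) ∧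
    (∀ᵐ ω ∂P, h ω 0 = 0) ∧
    ∀ n : ℤ, ∀ᵐ ω ∂P, ∀ x : ℝ,
      PhiLin A θ n ω * x = (h (iterZ θ n ω)).symm (PhiLin B θ n ω * h ω x)

/-- A measurable set `K` is a coboundary for `θ` if `K = H ∆ θ(H)` up to a `P`-null set,
for some measurable `H`. -/
def IsCoboundary (P : Measure Ω) (θ : Ω ≃ᵐ Ω) (K : Set Ω) : Prop :=
  ∃ H : Set Ω, MeasurableSet H ∧ P (symmDiff K (symmDiff H (⇑θ.symm ⁻¹' H))) = 0


def maxS (T : Ω → Ω) (g : Ω → ℝ) : ℕ → Ω → ℝ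
  | 0 => g
  | n + 1 => fun ω => g ω + max 0 (maxS T g n (T ω))

lemma maxS_mono_succ (T : Ω → Ω) (g : Ω → ℝ) (n : ℕ) : ∀ ω, maxS T g n ω ≤ maxS T g (n+1) ω := by
  induction n with
  | zero => intro ω; simp [maxS]
  | succ k ih =>
    intro ω
    have := ih (T ω)
    simp only [maxS] at this ⊢
    gcongr

lemma maxS_mono (T : Ω → Ω) (g : Ω → ℝ) (ω : Ω) : Monotone (fun n => maxS T g n ω) :=
  monotone_nat_of_le_succ fun n => maxS_mono_succ T g n ω

lemma birkhoff_le_maxS (T : Ω → Ω) (g : Ω → ℝ) (n : ℕ) :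
    ∀ ω, birkhoffSum T g (n+1) ω ≤ maxS T g n ω := by
  induction n with
  | zero => intro ω; simp [maxS]
  | succ k ih =>
    intro ω
    rw [birkhoffSum_succ']
    have := ih (T ω)
    simp only [maxS]
    have := le_max_right 0 (maxS T g k (T ω))
    linarith

lemma maxS_measurable {T : Ω → Ω} {g : Ω → ℝ} (hT : Measurable T) (hg : Measurable g) (n : ℕ) :
    Measurable (maxS T g n) := by
  induction n with
  | zero => exact hg
  | succ k ih => exact hg.add (measurable_const.max (ih.comp hT))

lemma maxS_integrable {P : Measure Ω} {T : Ω → Ω} {g : Ω → ℝ}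
    (hT : MeasurePreserving T P P) (hg : Integrable g P) (n : ℕ) :
    Integrable (maxS T g n) P := by
  induction n with
  | zero => exact hg
  | succ k ih =>
    have h1 : Integrable (fun ω => maxS T g k (T ω)) P := hT.integrable_comp_of_integrable ih
    have h2 : Integrable (fun ω => max 0 (maxS T g k (T ω))) P := by
      have := h1.pos_part
      simpa [max_comm] using this
    exact hg.add h2

lemma birkhoff_measurable {T : Ω → Ω} {g : Ω → ℝ} (hT : Measurable T) (hg : Measurable g) (n : ℕ) :
    Measurable (birkhoffSum T g n) := by
  unfold birkhoffSum
  exact Finset.measurable_fun_sum _ fun k _ => hg.comp (hT.iterate k)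

lemma bdd_of_neg {P : Measure Ω} [IsProbabilityMeasure P] {T : Ω → Ω} {g : Ω → ℝ}
    (hT : Ergodic T P) (hgm : Measurable g) (hg : Integrable g P) (hneg : ∫ ω, g ω ∂P < 0) :
    ∀ᵐ ω ∂P, BddAbove (range fun n => birkhoffSum T g n ω) := by
  have hmp := hT.toMeasurePreserving
  set E : Set Ω := {ω | BddAbove (range fun n => birkhoffSum T g n ω)} with hE
  have hEm : MeasurableSet E :=
    measurableSet_bddAbove_range (fun n => birkhoff_measurable hmp.measurable hgm n)
  have hinv : T ⁻¹' E = E := by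
    ext ω
    simp only [hE, mem_preimage, mem_ofPred_eq]
    constructor
    · rintro ⟨C, hC⟩
      refine ⟨max 0 (g ω + C), ?_⟩
      rintro _ ⟨n, rfl⟩
      rcases n with _ | n
      · simp
      · have := hC ⟨n, rfl⟩
        simp only [birkhoffSum_succ'] at this ⊢
        apply le_max_of_le_right
        linarith
    · rintro ⟨C, hC⟩
      refine ⟨C - g ω, ?_⟩
      rintro _ ⟨n, rfl⟩
      have := hC ⟨n+1, rfl⟩
      simp only [birkhoffSum_succ'] at this ⊢
      linarith
  rcases hT.toPreErgodic.ae_mem_or_ae_notMem hEm hinv with h | h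
  · exact h
  exfalso
  have hlim : Tendsto (fun n => ∫ ω, (maxS T g (n+1) ω - maxS T g n (T ω)) ∂P) atTop
      (nhds (∫ ω, g ω ∂P)) := by
    refine tendsto_integral_of_dominated_convergence (fun ω => |g ω| + |g (T ω)|) ?_ ?_ ?_ ?_
    · intro n
      exact ((maxS_measurable hmp.measurable hgm (n+1)).sub
        ((maxS_measurable hmp.measurable hgm n).comp hmp.measurable)).aestronglyMeasurable
    · exact hg.abs.add (hmp.integrable_comp_of_integrable hg.abs)
    · intro n
      refine Eventually.of_forall fun ω => ?_
      have h0 : g (T ω) ≤ maxS T g n (T ω) := maxS_mono T g (T ω) (Nat.zero_le n)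
      simp only [maxS, Real.norm_eq_abs]
      rcases le_total 0 (maxS T g n (T ω)) with h | h
      · rw [max_eq_right h]
        simp
      · rw [max_eq_left h]
        have := neg_abs_le (g (T ω))
        have h3 : |maxS T g n (T ω)| ≤ |g (T ω)| := by
          rw [abs_of_nonpos h]; linarith
        calc |g ω + 0 - maxS T g n (T ω)| ≤ |g ω + 0| + |maxS T g n (T ω)| := abs_sub _ _
          _ ≤ _ := by rw [add_zero]; gcongr
    · filter_upwards [h] with ω hω
      have hω' : T ω ∉ E := fun h' => hω (by rw [← hinv]; exact h')
      have : ∃ n, 0 < maxS T g n (T ω) := by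
        by_contra! hcon
        apply hω'
        refine ⟨0, ?_⟩
        rintro _ ⟨n, rfl⟩
        rcases n with _ | n
        · simp
        · exact (birkhoff_le_maxS T g n (T ω)).trans (hcon n)
      obtain ⟨N, hN⟩ := this
      apply tendsto_const_nhds.congr'
      filter_upwards [eventually_ge_atTop N] with n hn
      have := hN.trans_le (maxS_mono T g (T ω) hn)
      simp only [maxS]
      rw [max_eq_right this.le]; ring
  have hnn : ∀ n, 0 ≤ ∫ ω, (maxS T g (n+1) ω - maxS T g n (T ω)) ∂P := by
    intro n
    have i1 := maxS_integrable hmp hg n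
    have i2 := maxS_integrable hmp hg (n+1)
    have i3 : Integrable (fun ω => maxS T g n (T ω)) P := hmp.integrable_comp_of_integrable i1
    rw [integral_sub i2 i3]
    have : ∫ ω, maxS T g n (T ω) ∂P = ∫ ω, maxS T g n ω ∂P := by
      have := integral_map (μ := P) hmp.measurable.aemeasurable (f := maxS T g n)
        (by rw [hmp.map_eq]; exact i1.aestronglyMeasurable)
      rw [hmp.map_eq] at this
      exact this.symm
    rw [this, sub_nonneg]
    exact integral_mono i1 i2 (maxS_mono_succ T g n)
  have := ge_of_tendsto' hlim hnn
  linarith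

lemma growth {P : Measure Ω} [IsProbabilityMeasure P] {T : Ω → Ω} {a : Ω → ℝ}
    (hT : Ergodic T P) (ham : Measurable a) (ha : Integrable a P) (hpos : 0 < ∫ ω, a ω ∂P) :
    ∃ c : ℝ, 0 < c ∧ ∀ᵐ ω ∂P, ∃ C : ℝ, ∀ n : ℕ, c * n - C ≤ birkhoffSum T a n ω := by
  refine ⟨(∫ ω, a ω ∂P) / 2, by linarith, ?_⟩
  set c := (∫ ω, a ω ∂P) / 2 with hc
  have h := bdd_of_neg (g := fun ω => c - a ω) hT (measurable_const.sub ham)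
    ((integrable_const c).sub ha) (by
      rw [integral_sub (integrable_const c) ha]; simp; linarith)
  filter_upwards [h] with ω ⟨C, hC⟩
  refine ⟨C, fun n => ?_⟩
  have := hC ⟨n, rfl⟩
  simp only [birkhoffSum, Finset.sum_sub_distrib] at this ⊢
  simp at this
  linarith

lemma tendsto_birkhoff {P : Measure Ω} [IsProbabilityMeasure P] {T : Ω → Ω} {a : Ω → ℝ}
    (hT : Ergodic T P) (ham : Measurable a) (ha : Integrable a P) (hpos : 0 < ∫ ω, a ω ∂P) :
    ∀ᵐ ω ∂P, Tendsto (fun n => birkhoffSum T a n ω) atTop atTop := by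
  obtain ⟨c, hc, h⟩ := growth hT ham ha hpos
  filter_upwards [h] with ω ⟨C, hC⟩
  refine tendsto_atTop_mono hC ?_
  apply tendsto_atTop_add_const_right
  exact tendsto_natCast_atTop_atTop.const_mul_atTop hc

lemma summable_exp {P : Measure Ω} [IsProbabilityMeasure P] {T : Ω → Ω} {a : Ω → ℝ}
    (hT : Ergodic T P) (ham : Measurable a) (ha : Integrable a P) (hpos : 0 < ∫ ω, a ω ∂P) :
    ∀ᵐ ω ∂P, Summable (fun n => exp (-birkhoffSum T a n ω)) := by
  obtain ⟨c, hc, h⟩ := growth hT ham ha hpos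
  filter_upwards [h] with ω ⟨C, hC⟩
  have hs : Summable (fun n : ℕ => exp C * exp (n * (-c))) :=
    (Real.summable_exp_nat_mul_iff.2 (by linarith)).mul_left _
  refine hs.of_nonneg_of_le (fun n => (exp_pos _).le) fun n => ?_
  rw [← exp_add]
  apply exp_le_exp.2
  have := hC n
  linarith

def W (u : ℕ → ℝ) (t : ℝ) : ℝ := ∑' n, Real.sigmoid (t - u n)

lemma sigmoid_le_exp (x : ℝ) : Real.sigmoid x ≤ exp x := by
  rw [Real.sigmoid_def]
  rw [inv_le_comm₀ (by positivity) (exp_pos _), ← exp_neg]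
  linarith

lemma W_summable {u : ℕ → ℝ} (hu : Summable fun n => exp (-u n)) (t : ℝ) :
    Summable fun n => Real.sigmoid (t - u n) := by
  refine (hu.mul_left (exp t)).of_nonneg_of_le (fun n => Real.sigmoid_nonneg _) fun n => ?_
  rw [← exp_add, ← sub_eq_add_neg]
  exact sigmoid_le_exp _

lemma W_strictMono {u : ℕ → ℝ} (hu : Summable fun n => exp (-u n)) : StrictMono (W u) := by
  intro s t hst
  exact (W_summable hu s).tsum_lt_tsum (i := 0) (fun n => Real.sigmoid_le (by linarith))
    (Real.sigmoid_lt (by linarith)) (W_summable hu t)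

lemma W_continuous {u : ℕ → ℝ} (hu : Summable fun n => exp (-u n)) : Continuous (W u) := by
  rw [continuous_iff_continuousAt]
  intro t
  have : ContinuousOn (W u) (Iio (t+1)) := by
    refine continuousOn_tsum (u := fun n => exp (t+1) * exp (-u n)) ?_ (hu.mul_left _) ?_
    · intro n
      exact (_root_.continuous_sigmoid.comp (continuous_id.sub continuous_const)).continuousOn
    · intro n x hx
      rw [Real.norm_eq_abs, abs_of_nonneg (Real.sigmoid_nonneg _), ← exp_add]
      refine (sigmoid_le_exp _).trans (exp_le_exp.2 ?_)
      have : x < t + 1 := hx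
      linarith
  exact this.continuousAt (Iio_mem_nhds (by linarith))

lemma W_tendsto {u : ℕ → ℝ} (hu : Summable fun n => exp (-u n)) : Tendsto (W u) atTop atTop := by
  rw [tendsto_atTop]
  intro b
  obtain ⟨N, hN⟩ := exists_nat_gt b
  have h : Tendsto (fun t => ∑ n ∈ Finset.range N, Real.sigmoid (t - u n)) atTop
      (nhds (∑ n ∈ Finset.range N, (1:ℝ))) := by
    refine tendsto_finsetSum _ fun n _ => ?_
    refine Real.tendsto_sigmoid_atTop.comp ?_
    exact tendsto_atTop_add_const_right _ _ tendsto_id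
  have hb : b < ∑ n ∈ Finset.range N, (1:ℝ) := by simpa using hN
  filter_upwards [h.eventually_const_lt hb] with t ht
  exact ht.le.trans ((W_summable hu t).sum_le_tsum _ fun n _ => Real.sigmoid_nonneg _)

def FF (u v : ℕ → ℝ) (t : ℝ) : ℝ := W u t - W v (-t)

lemma FF_strictMono {u v : ℕ → ℝ} (hu : Summable fun n => exp (-u n))
    (hv : Summable fun n => exp (-v n)) : StrictMono (FF u v) := by
  intro s t hst
  have h1 := W_strictMono hu hst
  have h2 := W_strictMono hv (neg_lt_neg hst)
  unfold FF; linarith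

lemma FF_tendsto {u v : ℕ → ℝ} (hu : Summable fun n => exp (-u n))
    (hv : Summable fun n => exp (-v n)) : Tendsto (FF u v) atTop atTop := by
  have h : Tendsto (fun t => W u t + -W v 0) atTop atTop :=
    tendsto_atTop_add_const_right _ _ (W_tendsto hu)
  refine tendsto_atTop_mono' _ ?_ h
  filter_upwards [eventually_ge_atTop 0] with t ht
  have := (W_strictMono hv).monotone (show -t ≤ 0 by linarith)
  unfold FF; linarith

lemma FF_surj {u v : ℕ → ℝ} (hu : Summable fun n => exp (-u n))
    (hv : Summable fun n => exp (-v n)) : Surjective (FF u v) := by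
  have hc : Continuous (FF u v) := (W_continuous hu).sub ((W_continuous hv).comp continuous_neg)
  refine hc.surjective (FF_tendsto hu hv) ?_
  have h := (tendsto_neg_atTop_atBot).comp ((FF_tendsto hv hu).comp tendsto_neg_atBot_atTop)
  refine h.congr fun t => ?_
  simp [FF]

lemma exists_F {P : Measure Ω} [IsProbabilityMeasure P] {θ : Ω ≃ᵐ Ω} {a : Ω → ℝ}
    (hθ : Ergodic θ P) (ham : Measurable a) (ha : Integrable a P) (hpos : 0 < ∫ ω, a ω ∂P) :
    ∃ F : Ω → (ℝ ≃o ℝ), Measurable (fun p : Ω × ℝ => F p.1 p.2) ∧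
      Measurable (fun p : Ω × ℝ => (F p.1).symm p.2) ∧
      ∀ᵐ ω ∂P, ∀ t, F (θ ω) (t + a ω) = F ω t + 1 := by
  classical
  have hmp := hθ.toMeasurePreserving
  have hmpi := hθ.symm.toMeasurePreserving
  have ha' : Integrable (fun ω => a (θ.symm ω)) P := hmpi.integrable_comp_of_integrable ha
  have ham' : Measurable (fun ω => a (θ.symm ω)) := ham.comp θ.symm.measurable
  have hint' : ∫ ω, a (θ.symm ω) ∂P = ∫ ω, a ω ∂P := hmpi.integral_comp' (f := θ.symm) a
  set u : Ω → ℕ → ℝ := fun ω n => birkhoffSum θ.symm (fun ω => a (θ.symm ω)) n ω with hu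
  set v : Ω → ℕ → ℝ := fun ω n => birkhoffSum θ a (n+1) ω with hv
  have hus : ∀ᵐ ω ∂P, Summable fun n => exp (-u ω n) :=
    summable_exp hθ.symm ham' ha' (by rw [hint']; exact hpos)
  have hvs : ∀ᵐ ω ∂P, Summable fun n => exp (-v ω n) := by
    filter_upwards [summable_exp hθ ham ha hpos] with ω h
    exact (summable_nat_add_iff 1).2 h
  have hum : ∀ n, Measurable fun ω => u ω n := birkhoff_measurable θ.symm.measurable ham'
  have hvm : ∀ n, Measurable fun ω => v ω n := fun n => birkhoff_measurable θ.measurable ham (n+1)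
  obtain ⟨G, hGsub, hGm, hG⟩ : ∃ G : Set Ω, (∀ ω ∈ G, (Summable fun n => exp (-u ω n)) ∧
      Summable fun n => exp (-v ω n)) ∧ MeasurableSet G ∧ ∀ᵐ ω ∂P, ω ∈ G := by
    have := hus.and hvs
    obtain ⟨s, hs, hsm, hs0⟩ := exists_measurable_superset_of_null this
    refine ⟨sᶜ, fun ω hω => ?_, hsm.compl, ?_⟩
    · by_contra hcon; exact hω (hs hcon)
    · exact compl_mem_ae_iff.2 hs0
  let F : Ω → (ℝ ≃o ℝ) := fun ω => if h : ω ∈ G then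
    (FF_strictMono (hGsub ω h).1 (hGsub ω h).2).orderIsoOfSurjective _
      (FF_surj (hGsub ω h).1 (hGsub ω h).2) else OrderIso.refl ℝ
  have hF1 : ∀ ω ∈ G, ∀ t, F ω t = FF (u ω) (v ω) t := by
    intro ω h t
    simp only [F, dif_pos h]
    rfl
  have hF2 : ∀ ω, ω ∉ G → ∀ t, F ω t = t := by
    intro ω h t
    simp only [F, dif_neg h]
    rfl
  have hFFm : Measurable (fun p : Ω × ℝ => FF (u p.1) (v p.1) p.2) := by
    unfold FF W
    refine Measurable.sub (Measurable.tsum fun n => ?_) (Measurable.tsum fun n => ?_)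
    · exact _root_.continuous_sigmoid.measurable.comp
        (measurable_snd.sub ((hum n).comp measurable_fst))
    · exact _root_.continuous_sigmoid.measurable.comp
        (measurable_snd.neg.sub ((hvm n).comp measurable_fst))
  have hFm : Measurable (fun p : Ω × ℝ => F p.1 p.2) := by
    have : (fun p : Ω × ℝ => F p.1 p.2) =
        fun p => if p.1 ∈ G then FF (u p.1) (v p.1) p.2 else p.2 := by
      ext p
      split_ifs with h
      · exact hF1 _ h _
      · exact hF2 _ h _
    rw [this]
    exact Measurable.ite (measurable_fst hGm) hFFm measurable_snd
  refine ⟨F, hFm, ?_, ?_⟩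
  · refine measurable_of_Iic fun t => ?_
    have : (fun p : Ω × ℝ => (F p.1).symm p.2) ⁻¹' Iic t = {p | p.2 ≤ F p.1 t} := by
      ext p
      simp only [mem_preimage, mem_Iic, mem_ofPred_eq]
      exact OrderIso.symm_apply_le _
    rw [this]
    exact measurableSet_le measurable_snd
      (hFm.comp (measurable_fst.prodMk measurable_const))
  · filter_upwards [hG, hmp.quasiMeasurePreserving.ae hG] with ω h1 h2 t
    rw [hF1 _ h1, hF1 _ h2]
    have hS1 := W_summable (hGsub _ h2).1 (t + a ω)
    have hS2 := W_summable (hGsub _ h1).2 (-t)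
    unfold FF W
    rw [hS1.tsum_eq_zero_add, hS2.tsum_eq_zero_add]
    have e1 : ∀ n, t + a ω - u (θ ω) (n+1) = t - u ω n := by
      intro n
      simp only [hu, birkhoffSum_succ', MeasurableEquiv.symm_apply_apply]
      ring
    have e2 : ∀ n, -(t + a ω) - v (θ ω) n = -t - v ω (n+1) := by
      intro n
      simp only [hv]
      rw [birkhoffSum_succ' _ _ (n+1) ω]
      ring
    simp only [e1, e2]
    have e3 : t + a ω - u (θ ω) 0 = t + a ω := by simp [hu]
    have e4 : -t - v ω 0 = -(t + a ω) := by simp [hv]; ring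
    rw [e3, e4, Real.sigmoid_neg]
    ring

lemma exists_G {P : Measure Ω} [IsProbabilityMeasure P] {θ : Ω ≃ᵐ Ω} {a b : Ω → ℝ}
    (hθ : Ergodic θ P) (ham : Measurable a) (ha : Integrable a P) (hapos : 0 < ∫ ω, a ω ∂P)
    (hbm : Measurable b) (hb : Integrable b P) (hbpos : 0 < ∫ ω, b ω ∂P) :
    ∃ F : Ω → (ℝ ≃o ℝ), Measurable (fun p : Ω × ℝ => F p.1 p.2) ∧
      ∀ᵐ ω ∂P, ∀ t, F (θ ω) (t + a ω) = F ω t + b ω := by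
  obtain ⟨Fa, ma, -, ha⟩ := exists_F hθ ham ha hapos
  obtain ⟨Fb, -, mb, hb⟩ := exists_F hθ hbm hb hbpos
  refine ⟨fun ω => (Fa ω).trans (Fb ω).symm, mb.comp (measurable_fst.prodMk ma), ?_⟩
  filter_upwards [ha, hb] with ω h1 h2 t
  simp only [OrderIso.trans_apply]
  rw [h1, OrderIso.symm_apply_eq, h2, OrderIso.apply_symm_apply]

lemma exists_G' {P : Measure Ω} [IsProbabilityMeasure P] {θ : Ω ≃ᵐ Ω} {a b : Ω → ℝ}
    (hθ : Ergodic θ P) (ham : Measurable a) (ha : Integrable a P) (ha0 : ∫ ω, a ω ∂P ≠ 0)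
    (hbm : Measurable b) (hb : Integrable b P)
    (hsign : Real.sign (∫ ω, a ω ∂P) = Real.sign (∫ ω, b ω ∂P)) :
    ∃ F : Ω → (ℝ ≃o ℝ), Measurable (fun p : Ω × ℝ => F p.1 p.2) ∧
      ∀ᵐ ω ∂P, ∀ t, F (θ ω) (t + a ω) = F ω t + b ω := by
  rcases lt_or_gt_of_ne ha0 with h | h
  · have hb' : ∫ ω, b ω ∂P < 0 := by
      rw [Real.sign_of_neg h] at hsign
      by_contra hcon
      rcases (not_lt.1 hcon).eq_or_lt with h' | h'
      · rw [← h', Real.sign_zero] at hsign; norm_num at hsign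
      · rw [Real.sign_of_pos h'] at hsign; norm_num at hsign
    obtain ⟨F, hF, hF2⟩ := exists_G (a := fun ω => - a ω) (b := fun ω => - b ω) hθ ham.neg ha.neg
      (by rw [integral_neg]; linarith) hbm.neg hb.neg (by rw [integral_neg]; linarith)
    have hsm : ∀ ω, StrictMono fun t => -(F ω (-t)) := fun ω s t hst =>
      neg_lt_neg ((F ω).strictMono (neg_lt_neg hst))
    have hsu : ∀ ω, Surjective fun t => -(F ω (-t)) := fun ω y =>
      ⟨-((F ω).symm (-y)), by simp⟩
    refine ⟨fun ω => (hsm ω).orderIsoOfSurjective _ (hsu ω), ?_, ?_⟩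
    · exact (hF.comp (measurable_fst.prodMk measurable_snd.neg)).neg
    · filter_upwards [hF2] with ω h t
      have := h (-t)
      change -(F (θ ω) (-(t + a ω))) = -(F ω (-t)) + b ω
      rw [show -(t + a ω) = -t + -a ω by ring, this]
      ring
  · have hb' : 0 < ∫ ω, b ω ∂P := by
      rw [Real.sign_of_pos h] at hsign
      by_contra hcon
      rcases (not_lt.1 hcon).eq_or_lt with h' | h'
      · rw [h', Real.sign_zero] at hsign; norm_num at hsign
      · rw [Real.sign_of_neg h'] at hsign; norm_num at hsign
    exact exists_G hθ ham ha h hbm hb hb'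

def oddE (f : ℝ → ℝ) (x : ℝ) : ℝ :=
  if 0 < x then exp (f (log x)) else if x < 0 then -exp (f (log (-x))) else 0

lemma oddE_zero (f : ℝ → ℝ) : oddE f 0 = 0 := by simp [oddE]

lemma oddE_pos (f : ℝ → ℝ) {x : ℝ} (hx : 0 < x) : oddE f x = exp (f (log x)) := by simp [oddE, hx]

lemma oddE_neg (f : ℝ → ℝ) (x : ℝ) : oddE f (-x) = -oddE f x := by
  rcases lt_trichotomy x 0 with h | h | h
  · simp [oddE, h, h.le, not_lt.2 h.le]
  · simp [oddE, h]
  · simp [oddE, h, h.le, not_lt.2 h.le]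

lemma oddE_mul {f f' : ℝ → ℝ} {c d : ℝ} (hc : 0 < c) (h : ∀ t, f' (t + log c) = f t + d) (x : ℝ) :
    oddE f' (c * x) = exp d * oddE f x := by
  have key : ∀ x, 0 < x → oddE f' (c * x) = exp d * oddE f x := by
    intro x hx
    rw [oddE_pos _ hx, oddE_pos _ (mul_pos hc hx), log_mul hc.ne' hx.ne', add_comm (log c), h,
      exp_add, mul_comm]
  rcases lt_trichotomy x 0 with h | h | h
  · have := key (-x) (by linarith)
    rw [mul_neg, oddE_neg, oddE_neg] at this
    linarith
  · simp [h, oddE_zero]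
  · exact key x h

lemma oddE_strictMono {f : ℝ → ℝ} (hf : StrictMono f) : StrictMono (oddE f) := by
  have hp : ∀ x, 0 < x → 0 < oddE f x := fun x hx => by rw [oddE_pos _ hx]; exact exp_pos _
  have hpp : ∀ x y, 0 < x → x < y → oddE f x < oddE f y := fun x y hx hxy => by
    rw [oddE_pos _ hx, oddE_pos _ (hx.trans hxy)]
    exact exp_lt_exp.2 (hf (log_lt_log hx hxy))
  have hn : ∀ x, x < 0 → oddE f x < 0 := fun x hx => by
    have := hp (-x) (by linarith)
    rw [oddE_neg] at this; linarith
  intro x y hxy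
  rcases lt_trichotomy x 0 with h | h | h
  · rcases lt_trichotomy y 0 with h' | h' | h'
    · have := hpp (-y) (-x) (by linarith) (by linarith)
      rw [oddE_neg, oddE_neg] at this; linarith
    · rw [h', oddE_zero]; exact hn x h
    · exact (hn x h).trans (hp y h')
  · subst h; rw [oddE_zero]; exact hp y hxy
  · exact hpp x y h hxy

lemma oddE_surj {f : ℝ → ℝ} (hf : Surjective f) : Surjective (oddE f) := by
  have key : ∀ y, 0 < y → ∃ x, oddE f x = y := by
    intro y hy
    obtain ⟨t, ht⟩ := hf (log y)
    exact ⟨exp t, by rw [oddE_pos _ (exp_pos _), log_exp, ht, exp_log hy]⟩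
  intro y
  rcases lt_trichotomy y 0 with h | h | h
  · obtain ⟨x, hx⟩ := key (-y) (by linarith)
    exact ⟨-x, by rw [oddE_neg, hx]; ring⟩
  · exact ⟨0, by rw [oddE_zero, h]⟩
  · exact key y h

def oddHomeo (f : ℝ ≃o ℝ) : Homeomorph ℝ ℝ :=
  ((oddE_strictMono f.strictMono).orderIsoOfSurjective _ (oddE_surj f.surjective)).toHomeomorph

lemma oddHomeo_apply (f : ℝ ≃o ℝ) (x : ℝ) : oddHomeo f x = oddE f x := rfl

lemma prodA_ne (A : Ω → ℝ) (hA0 : ∀ ω, A ω ≠ 0) (T : Ω → Ω) (n : ℕ) (ω : Ω) :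
    prodA A T n ω ≠ 0 := by
  induction n with
  | zero => simp [prodA]
  | succ k ih => exact mul_ne_zero (hA0 _) ih

lemma prodA_abs (A : Ω → ℝ) (hA0 : ∀ ω, A ω ≠ 0) (T : Ω → Ω) (n : ℕ) (ω : Ω) :
    |prodA A T n ω| = exp (birkhoffSum T (fun ω => log |A ω|) n ω) := by
  induction n with
  | zero => simp [prodA]
  | succ k ih =>
    rw [birkhoffSum_succ, exp_add, exp_log (abs_pos.2 (hA0 _)), ← ih]
    simp [prodA, abs_mul, mul_comm]

lemma sgn_case {x y : ℝ} (hx : x ≠ 0) (hy : y ≠ 0) :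
    Real.sign x * Real.sign y = -1 ↔ ¬ (0 < x ↔ 0 < y) := by
  rcases lt_or_gt_of_ne hx with h | h <;> rcases lt_or_gt_of_ne hy with h' | h'
  · simp [Real.sign_of_neg h, Real.sign_of_neg h', h.le, h'.le, not_lt.2 h.le, not_lt.2 h'.le]; norm_num
  · simp [Real.sign_of_neg h, Real.sign_of_pos h', not_lt.2 h.le, h']
  · simp [Real.sign_of_pos h, Real.sign_of_neg h', h, not_lt.2 h'.le]
  · simp [Real.sign_of_pos h, Real.sign_of_pos h', h, h']; norm_num

lemma homeo_mono (h : Homeomorph ℝ ℝ) : StrictMono h ∨ StrictAnti h :=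
  h.continuous.strictMono_of_inj h.injective

lemma homeo_pos {h : Homeomorph ℝ ℝ} (h0 : h 0 = 0) {x : ℝ} (hx : x ≠ 0) :
    0 < h x ↔ (0 < x ↔ 0 < h 1) := by
  rcases homeo_mono h with hm | hm
  · have h1 : 0 < h 1 := by rw [← h0]; exact hm one_pos
    have : 0 < h x ↔ 0 < x := by rw [← h0, hm.lt_iff_lt, h0]
    simp [this, h1]
  · have h1 : ¬ 0 < h 1 := by rw [← h0, hm.lt_iff_gt]; simp
    have : 0 < h x ↔ x < 0 := by rw [← h0, hm.lt_iff_gt, h0]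
    simp only [this, h1, iff_false, not_lt]
    exact ⟨le_of_lt, fun h => lt_of_le_of_ne h hx⟩

lemma homeo_ne {h : Homeomorph ℝ ℝ} (h0 : h 0 = 0) {x : ℝ} (hx : x ≠ 0) : h x ≠ 0 := by
  rw [← h0]; exact fun h' => hx (h.injective h')

lemma homeo_ge {h : Homeomorph ℝ ℝ} {δ x : ℝ} (h0 : h 0 = 0) (h1 : δ ≤ |h 1|) (h2 : δ ≤ |h (-1)|)
    (hx : 1 ≤ |x|) : δ ≤ |h x| := by
  rcases homeo_mono h with hm | hm <;> rcases le_abs.1 hx with hx | hx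
  · have a1 := hm.monotone (show (0:ℝ) ≤ 1 by norm_num)
    have a2 := hm.monotone hx
    rw [h0] at a1
    rw [abs_of_nonneg a1] at h1
    rw [abs_of_nonneg (a1.trans a2)]; linarith
  · have a1 := hm.monotone (show (-1:ℝ) ≤ 0 by norm_num)
    have a2 := hm.monotone (show x ≤ -1 by linarith)
    rw [h0] at a1
    rw [abs_of_nonpos a1] at h2
    rw [abs_of_nonpos (a2.trans a1)]; linarith
  · have a1 := hm.antitone (show (0:ℝ) ≤ 1 by norm_num)
    have a2 := hm.antitone hx
    rw [h0] at a1
    rw [abs_of_nonpos a1] at h1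
    rw [abs_of_nonpos (a2.trans a1)]; linarith
  · have a1 := hm.antitone (show (-1:ℝ) ≤ 0 by norm_num)
    have a2 := hm.antitone (show x ≤ -1 by linarith)
    rw [h0] at a1
    rw [abs_of_nonneg a1] at h2
    rw [abs_of_nonneg (a1.trans a2)]; linarith

lemma homeo_le {h : Homeomorph ℝ ℝ} {K x : ℝ} (h1 : |h 1| ≤ K) (h2 : |h (-1)| ≤ K)
    (hx : |x| ≤ 1) : |h x| ≤ K := by
  rw [abs_le] at *
  rcases homeo_mono h with hm | hm
  · have a1 := hm.monotone hx.1
    have a2 := hm.monotone hx.2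
    constructor <;> linarith
  · have a1 := hm.antitone hx.1
    have a2 := hm.antitone hx.2
    constructor <;> linarith

lemma conj_backward (P : Measure Ω) [IsProbabilityMeasure P] (θ : Ω ≃ᵐ Ω)
    (herg : Ergodic (⇑θ) P)
    (A B : Ω → ℝ) (hA : Measurable A) (hB : Measurable B)
    (hA0 : ∀ ω, A ω ≠ 0) (hB0 : ∀ ω, B ω ≠ 0)
    (hAint : Integrable (fun ω => Real.log |A ω|) P)
    (hBint : Integrable (fun ω => Real.log |B ω|) P)
    (hAhyp : ∫ ω, Real.log |A ω| ∂P ≠ 0)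
    (hsign : Real.sign (∫ ω, Real.log |A ω| ∂P) = Real.sign (∫ ω, Real.log |B ω| ∂P))
    (hcob : IsCoboundary P θ {ω | Real.sign (A ω) * Real.sign (B ω) = -1}) :
    LinConjugate P θ A B := by
  classical
  have habs : Measurable (fun x : ℝ => |x|) := continuous_abs.measurable
  obtain ⟨F, hFm, hF⟩ := exists_G' herg (measurable_log.comp (habs.comp hA)) hAint hAhyp
    (measurable_log.comp (habs.comp hB)) hBint hsign
  obtain ⟨H, hHm, hH⟩ := hcob
  set G : Set Ω := ⇑θ.symm ⁻¹' H with hG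
  have hGm : MeasurableSet G := θ.symm.measurable hHm
  have hcob' : ∀ᵐ ω ∂P, (0 < A ω ↔ 0 < B ω) ↔ (θ ω ∈ G ↔ ω ∈ G) := by
    filter_upwards [compl_mem_ae_iff.2 hH] with ω hω
    have e1 : θ ω ∈ G ↔ ω ∈ H := by simp [hG]
    rw [e1]
    have e2 : ω ∈ {ω | Real.sign (A ω) * Real.sign (B ω) = -1} ↔ ¬ (0 < A ω ↔ 0 < B ω) :=
      sgn_case (hA0 ω) (hB0 ω)
    simp only [mem_compl_iff, Set.mem_symmDiff, e2] at hω
    tauto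
  let h : Ω → Homeomorph ℝ ℝ := fun ω =>
    if ω ∈ G then oddHomeo (F ω) else (oddHomeo (F ω)).trans (Homeomorph.neg ℝ)
  have hh1 : ∀ ω ∈ G, ∀ x, h ω x = oddE (F ω) x := fun ω hω x => by
    simp only [h, if_pos hω]; rfl
  have hh2 : ∀ ω, ω ∉ G → ∀ x, h ω x = -oddE (F ω) x := fun ω hω x => by
    simp only [h, if_neg hω]; rfl
  have hOm : Measurable (fun p : Ω × ℝ => oddE (F p.1) p.2) := by
    unfold oddE
    refine Measurable.ite (measurableSet_lt measurable_const measurable_snd) ?_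
      (Measurable.ite (measurableSet_lt measurable_snd measurable_const) ?_ measurable_const)
    · exact (hFm.comp (measurable_fst.prodMk (measurable_log.comp measurable_snd))).exp
    · exact (hFm.comp (measurable_fst.prodMk (measurable_log.comp measurable_snd.neg))).exp.neg
  have hstep : ∀ᵐ ω ∂P, ∀ x, h (θ ω) (A ω * x) = B ω * h ω x := by
    filter_upwards [hF, hcob'] with ω h1 h2 x
    have kx : oddE (F (θ ω)) (|A ω| * x) = exp (log |B ω|) * oddE (F ω) x :=
      oddE_mul (abs_pos.2 (hA0 ω)) h1 x
    rw [exp_log (abs_pos.2 (hB0 ω))] at kx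
    have cA : (0 < A ω ∧ oddE (F (θ ω)) (A ω * x) = |B ω| * oddE (F ω) x) ∨
        (¬ 0 < A ω ∧ oddE (F (θ ω)) (A ω * x) = -(|B ω| * oddE (F ω) x)) := by
      rcases lt_or_gt_of_ne (hA0 ω) with a | a
      · right
        rw [abs_of_neg a, neg_mul, oddE_neg] at kx
        exact ⟨not_lt.2 a.le, by linarith⟩
      · left
        rw [abs_of_pos a] at kx
        exact ⟨a, kx⟩
    have cB : (0 < B ω ∧ |B ω| = B ω) ∨ (¬ 0 < B ω ∧ |B ω| = -B ω) := by
      rcases lt_or_gt_of_ne (hB0 ω) with b | b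
      · exact Or.inr ⟨not_lt.2 b.le, abs_of_neg b⟩
      · exact Or.inl ⟨b, abs_of_pos b⟩
    have c1 : (ω ∈ G ∧ h ω x = oddE (F ω) x) ∨ (ω ∉ G ∧ h ω x = -oddE (F ω) x) := by
      by_cases g : ω ∈ G
      · exact Or.inl ⟨g, hh1 _ g x⟩
      · exact Or.inr ⟨g, hh2 _ g x⟩
    have c2 : (θ ω ∈ G ∧ h (θ ω) (A ω * x) = oddE (F (θ ω)) (A ω * x)) ∨
        (θ ω ∉ G ∧ h (θ ω) (A ω * x) = -oddE (F (θ ω)) (A ω * x)) := by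
      by_cases g : θ ω ∈ G
      · exact Or.inl ⟨g, hh1 _ g _⟩
      · exact Or.inr ⟨g, hh2 _ g _⟩
    rcases cA with ⟨p1, q1⟩ | ⟨p1, q1⟩ <;> rcases cB with ⟨p2, q2⟩ | ⟨p2, q2⟩ <;>
      rcases c1 with ⟨p3, q3⟩ | ⟨p3, q3⟩ <;> rcases c2 with ⟨p4, q4⟩ | ⟨p4, q4⟩ <;>
      first
        | (exfalso; simp [p1, p2, p3, p4] at h2; done)
        | (rw [q4, q3, q1, q2]; try ring)
  have hnat : ∀ n : ℕ, ∀ᵐ ω ∂P, ∀ x,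
      h (θ^[n] ω) (prodA A θ n ω * x) = prodA B θ n ω * h ω x := by
    intro n
    induction n with
    | zero => simp [prodA]
    | succ k ih =>
      have := (herg.toMeasurePreserving.iterate k).quasiMeasurePreserving.ae hstep
      filter_upwards [ih, this] with ω i1 i2 x
      rw [iterate_succ_apply']
      simp only [prodA]
      rw [mul_assoc, i2, i1, mul_assoc]
  refine ⟨h, ?_, ?_, ?_⟩
  · have : (fun p : Ω × ℝ => h p.1 p.2) =
        fun p => if p.1 ∈ G then oddE (F p.1) p.2 else -oddE (F p.1) p.2 := by
      ext p
      split_ifs with hp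
      · exact hh1 _ hp _
      · exact hh2 _ hp _
    rw [this]
    exact Measurable.ite (measurable_fst hGm) hOm hOm.neg
  · refine Eventually.of_forall fun ω => ?_
    by_cases hω : ω ∈ G
    · rw [hh1 _ hω, oddE_zero]
    · rw [hh2 _ hω, oddE_zero, neg_zero]
  · intro n
    by_cases hn : 0 ≤ n
    · filter_upwards [hnat n.toNat] with ω hω x
      simp only [PhiLin, iterZ, if_pos hn]
      rw [← hω, Homeomorph.symm_apply_apply]
    · have := (herg.symm.toMeasurePreserving.iterate (-n).toNat).quasiMeasurePreserving.ae
        (hnat (-n).toNat)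
      filter_upwards [this] with ω hω x
      simp only [PhiLin, iterZ, if_neg hn]
      set m := (-n).toNat
      set ω' := (⇑θ.symm)^[m] ω with hω'
      have e : (⇑θ)^[m] ω' = ω :=
        (show LeftInverse θ θ.symm from θ.apply_symm_apply).iterate m ω
      rw [e] at hω
      have hx := hω ((prodA A θ m ω')⁻¹ * x)
      rw [mul_inv_cancel_left₀ (prodA_ne A hA0 _ _ _)] at hx
      rw [hx, inv_mul_cancel_left₀ (prodA_ne B hB0 _ _ _), Homeomorph.symm_apply_apply]

lemma conj_forward (P : Measure Ω) [IsProbabilityMeasure P] (θ : Ω ≃ᵐ Ω)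
    (herg : Ergodic (⇑θ) P)
    (A B : Ω → ℝ) (hA : Measurable A) (hB : Measurable B)
    (hA0 : ∀ ω, A ω ≠ 0) (hB0 : ∀ ω, B ω ≠ 0)
    (hAint : Integrable (fun ω => Real.log |A ω|) P)
    (hBint : Integrable (fun ω => Real.log |B ω|) P)
    (hAhyp : ∫ ω, Real.log |A ω| ∂P ≠ 0)
    (hBhyp : ∫ ω, Real.log |B ω| ∂P ≠ 0)
    (hconj : LinConjugate P θ A B) :
    Real.sign (∫ ω, Real.log |A ω| ∂P) = Real.sign (∫ ω, Real.log |B ω| ∂P) ∧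
        IsCoboundary P θ {ω | Real.sign (A ω) * Real.sign (B ω) = -1} := by
  obtain ⟨h, hm, h0, hc⟩ := hconj
  have hmp := herg.toMeasurePreserving
  have habs : Measurable (fun x : ℝ => |x|) := continuous_abs.measurable
  have hAm : Measurable (fun ω => log |A ω|) := measurable_log.comp (habs.comp hA)
  have hBm : Measurable (fun ω => log |B ω|) := measurable_log.comp (habs.comp hB)
  have hnat : ∀ᵐ ω ∂P, ∀ n : ℕ, ∀ x, h (θ^[n] ω) (prodA A θ n ω * x) = prodA B θ n ω * h ω x := by
    rw [ae_all_iff]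
    intro n
    filter_upwards [hc n] with ω hω x
    have := hω x
    simp only [PhiLin, iterZ, Int.natCast_nonneg, if_true, Int.toNat_natCast] at this
    rw [this, Homeomorph.apply_symm_apply]
  have h0all : ∀ᵐ ω ∂P, ∀ n : ℕ, h (θ^[n] ω) 0 = 0 := by
    rw [ae_all_iff]
    intro n
    exact (hmp.iterate n).quasiMeasurePreserving.ae h0
  have hxm : ∀ x, Measurable fun ω => h ω x := fun x =>
    hm.comp (measurable_id.prodMk measurable_const)
  constructor
  · -- signs of the exponents
    let U : ℕ → Set Ω := fun k => {ω | (1/(k+1:ℝ) ≤ |h ω 1| ∧ 1/(k+1:ℝ) ≤ |h ω (-1)|) ∧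
      (|h ω 1| ≤ k ∧ |h ω (-1)| ≤ k)}
    have hUm : ∀ k, MeasurableSet (U k) := fun k =>
      ((measurableSet_le measurable_const (habs.comp (hxm 1))).inter
        (measurableSet_le measurable_const (habs.comp (hxm (-1))))).inter
      ((measurableSet_le (habs.comp (hxm 1)) measurable_const).inter
        (measurableSet_le (habs.comp (hxm (-1))) measurable_const))
    have hU : P (⋃ k, U k) ≠ 0 := by
      have : ∀ᵐ ω ∂P, ω ∈ ⋃ k, U k := by
        filter_upwards [h0] with ω hω
        have p1 := abs_pos.2 (homeo_ne hω (one_ne_zero))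
        have p2 := abs_pos.2 (homeo_ne hω (x := -1) (by norm_num))
        have e1 : ∀ᶠ k : ℕ in atTop, 1/(k+1:ℝ) < |h ω 1| :=
          tendsto_one_div_add_atTop_nhds_zero_nat.eventually_lt_const p1
        have e2 : ∀ᶠ k : ℕ in atTop, 1/(k+1:ℝ) < |h ω (-1)| :=
          tendsto_one_div_add_atTop_nhds_zero_nat.eventually_lt_const p2
        have e3 : ∀ᶠ k : ℕ in atTop, |h ω 1| ≤ k :=
          tendsto_natCast_atTop_atTop.eventually_ge_atTop _
        have e4 : ∀ᶠ k : ℕ in atTop, |h ω (-1)| ≤ k :=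
          tendsto_natCast_atTop_atTop.eventually_ge_atTop _
        obtain ⟨k, k1, k2, k3, k4⟩ := (e1.and (e2.and (e3.and e4))).exists
        exact mem_iUnion.2 ⟨k, ⟨k1.le, k2.le⟩, k3, k4⟩
      intro hz
      have h2 : ∀ᵐ ω ∂P, ω ∉ ⋃ k, U k := measure_eq_zero_iff_ae_notMem.1 hz
      obtain ⟨ω, a, b⟩ := (this.and h2).exists
      exact b a
    obtain ⟨k, hk⟩ := exists_measure_pos_of_not_measure_iUnion_null hU
    have hrec := hmp.conservative.ae_mem_imp_frequently_image_mem (hUm k).nullMeasurableSet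
    have hfreq : ∃ᵐ ω ∂P, ω ∈ U k := frequently_ae_mem_iff.2 hk.ne'
    have hgo : ∀ {a : Ω → ℝ}, Measurable a → Integrable a P → 0 < ∫ ω, a ω ∂P →
      ∀ᵐ ω ∂P, Tendsto (fun n => birkhoffSum θ a n ω) atTop atTop :=
      fun m i p => tendsto_birkhoff herg m i p
    have hneg : ∀ (a : Ω → ℝ) n ω, birkhoffSum θ (fun ω => - a ω) n ω = - birkhoffSum θ a n ω := by
      intro a n ω; simp [birkhoffSum]
    have hbot : ∀ {a : Ω → ℝ}, Measurable a → Integrable a P → ∫ ω, a ω ∂P < 0 →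
      ∀ᵐ ω ∂P, Tendsto (fun n => birkhoffSum θ a n ω) atTop atBot := by
      intro a m i p
      filter_upwards [hgo m.neg i.neg (by simp only [Pi.neg_apply]; rw [integral_neg]; linarith)]
        with ω hω
      have := tendsto_neg_atTop_atBot.comp hω
      refine this.congr fun n => ?_
      have e := hneg a n ω
      simp only [comp_apply]
      change - birkhoffSum θ (fun ω => - a ω) n ω = _
      rw [e, neg_neg]
    rcases lt_or_gt_of_ne hAhyp with a | a <;> rcases lt_or_gt_of_ne hBhyp with b | b
    · rw [Real.sign_of_neg a, Real.sign_of_neg b]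
    · exfalso
      obtain ⟨ω, ωU, r, t1, t2, hn, h0n⟩ := (hfreq.and_eventually (hrec.and ((hbot hAm hAint a).and
        ((hgo hBm hBint b).and (hnat.and h0all))))).exists
      have E1 := t1.eventually_le_atBot 0
      have E2 : Tendsto (fun n => |prodA B θ n ω| * |h ω 1|) atTop atTop := by
        simp only [prodA_abs B hB0]
        exact (tendsto_exp_atTop.comp t2).atTop_mul_const
          (abs_pos.2 (homeo_ne (h0n 0) one_ne_zero))
      obtain ⟨n, hn1, hn2, hn3⟩ := ((r ωU).and_eventually
        (E1.and (E2.eventually_gt_atTop (k:ℝ)))).exists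
      have := homeo_le hn1.2.1 hn1.2.2 (x := prodA A θ n ω * 1) (by
        rw [mul_one, prodA_abs A hA0]; exact exp_le_one_iff.2 hn2)
      rw [hn, abs_mul] at this
      linarith
    · exfalso
      obtain ⟨ω, ωU, r, t1, t2, hn, h0n⟩ := (hfreq.and_eventually (hrec.and ((hgo hAm hAint a).and
        ((hbot hBm hBint b).and (hnat.and h0all))))).exists
      have E1 := t1.eventually_ge_atTop 0
      have E2 : Tendsto (fun n => |prodA B θ n ω| * |h ω 1|) atTop (nhds (0 * |h ω 1|)) := by
        simp only [prodA_abs B hB0]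
        exact (tendsto_exp_atBot.comp t2).mul_const _
      rw [zero_mul] at E2
      obtain ⟨n, hn1, hn2, hn3⟩ := ((r ωU).and_eventually
        (E1.and (E2.eventually_lt_const (show (0:ℝ) < 1/(k+1:ℝ) by positivity)))).exists
      have := homeo_ge (h0n n) hn1.1.1 hn1.1.2 (x := prodA A θ n ω * 1) (by
        rw [mul_one, prodA_abs A hA0]; exact one_le_exp hn2)
      rw [hn, abs_mul] at this
      linarith
    · rw [Real.sign_of_pos a, Real.sign_of_pos b]
  · refine ⟨{ω | 0 < h (θ ω) 1}, measurableSet_lt measurable_const ((hxm 1).comp θ.measurable), ?_⟩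
    rw [measure_eq_zero_iff_ae_notMem]
    filter_upwards [hnat, h0all] with ω hn hz
    have e2 : ω ∈ {ω | Real.sign (A ω) * Real.sign (B ω) = -1} ↔ ¬ (0 < A ω ↔ 0 < B ω) :=
      sgn_case (hA0 ω) (hB0 ω)
    have h1 := hn 1 1
    have z0 : h ω 0 = 0 := hz 0
    have z1 : h (θ ω) 0 = 0 := hz 1
    simp only [prodA, iterate_one, iterate_zero, id, mul_one] at h1
    have k1 := homeo_pos z1 (hA0 ω)
    rw [h1] at k1
    have k2 : 0 < B ω * h ω 1 ↔ (0 < B ω ↔ 0 < h ω 1) := by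
      have n1 := homeo_ne z0 one_ne_zero
      rcases lt_or_gt_of_ne (hB0 ω) with b | b
      · rw [mul_pos_iff]
        rcases lt_or_gt_of_ne n1 with c | c <;> simp [b, c, not_lt.2 b.le, not_lt.2 c.le, c.le]
      · simp [b]
    simp only [Set.mem_symmDiff, e2, mem_preimage, mem_ofPred_eq, MeasurableEquiv.apply_symm_apply]
    tauto

/-- **Classification of one-dimensional linear hyperbolic cocycles (N.D. Cong):** two
one-dimensional linear hyperbolic cocycles `Φ_A`, `Φ_B` over the same invertible
measure-preserving ergodic `θ` are topologically conjugate iff (i) their Lyapunov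
exponents `λ_A = ∫ log|A| dP` and `λ_B = ∫ log|B| dP` have the same sign, and (ii) the
set `C_{AB} = {ω : sign A(ω) · sign B(ω) = −1}` is a coboundary. -/
theorem linear_cocycle_classification
    (P : Measure Ω) [IsProbabilityMeasure P] (θ : Ω ≃ᵐ Ω)
    (hθ : MeasurePreserving (⇑θ) P P) (hθinv : MeasurePreserving (⇑θ.symm) P P)
    (herg : Ergodic (⇑θ) P)
    (A B : Ω → ℝ) (hA : Measurable A) (hB : Measurable B)
    (hA0 : ∀ ω, A ω ≠ 0) (hB0 : ∀ ω, B ω ≠ 0)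
    (hAint : Integrable (fun ω => Real.log |A ω|) P)
    (hBint : Integrable (fun ω => Real.log |B ω|) P)
    (hAhyp : ∫ ω, Real.log |A ω| ∂P ≠ 0)
    (hBhyp : ∫ ω, Real.log |B ω| ∂P ≠ 0) :
    LinConjugate P θ A B ↔
      (Real.sign (∫ ω, Real.log |A ω| ∂P) = Real.sign (∫ ω, Real.log |B ω| ∂P) ∧
        IsCoboundary P θ {ω | Real.sign (A ω) * Real.sign (B ω) = -1}) := by
  constructor
  · exact conj_forward P θ herg A B hA hB hA0 hB0 hAint hBint hAhyp hBhyp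
  · rintro ⟨h1, h2⟩
    exact conj_backward P θ herg A B hA hB hA0 hB0 hAint hBint hAhyp h1 h2
end
end
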